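/- Let M be an SPLC market all of whose parameters (endowments w^i_j, shares θ^i_f, slopes u^i_{jk} and α^f_{jk}, lengths l^i_{jk} and o^f_{jk}) are rational numbers, and suppose M satisfies strong connectivity, no production out of nothing, and enough demand. Then M admits a market equilibrium in which all prices, all allocation amounts of agents, and all production-plan amounts of firms are rational numbers. -/

import Mathlib

open scoped Classical

noncomputable section

/-- An SPLC market: finitely many goods `G`, agents `A`, and firms `F`;
endowments `w`, firm ownership shares `θ`, firm `f` produces good `jf f`;
agent `i`'s utility for good `j` is SPLC with `numU i j` segments of slopes `u i j k`
and lengths `l i j k` (`k < numU i j`); firm `f`'s production of good `jf f` from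
raw good `j` is SPLC with `numP f j` segments of slopes `α f j k` and lengths `o f j k`. -/
structure SPLCMarket where
  (G A F : Type)
  [instG : Fintype G]
  [instA : Fintype A]
  [instF : Fintype F]
  (w : A → G → ℝ)
  (w_nonneg : ∀ i j, 0 ≤ w i j)
  (w_sum : ∀ j, ∑ i, w i j = 1)
  (jf : F → G)
  (θ : A → F → ℝ)
  (θ_nonneg : ∀ i f, 0 ≤ θ i f)
  (θ_sum : ∀ f, ∑ i, θ i f = 1)
  (numU : A → G → ℕ)
  (numU_pos : ∀ i j, 0 < numU i j)
  (u : A → G → ℕ → ℝ)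
  (l : A → G → ℕ → ℝ)
  (u_nonneg : ∀ i j k, k < numU i j → 0 ≤ u i j k)
  (l_pos : ∀ i j k, k < numU i j → 0 < l i j k)
  (u_anti : ∀ i j k, k + 1 < numU i j → u i j (k + 1) < u i j k)
  (numP : F → G → ℕ)
  (numP_pos : ∀ f j, 0 < numP f j)
  (α : F → G → ℕ → ℝ)
  (o : F → G → ℕ → ℝ)
  (α_nonneg : ∀ f j k, k < numP f j → 0 ≤ α f j k)
  (o_pos : ∀ f j k, k < numP f j → 0 < o f j k)
  (α_anti : ∀ f j k, k + 1 < numP f j → α f j (k + 1) < α f j k)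

attribute [instance] SPLCMarket.instG SPLCMarket.instA SPLCMarket.instF

namespace SPLCMarket

variable (M : SPLCMarket)

/-- A segment-indexed allocation: nonnegative, within segment lengths, zero beyond
the actual segments. -/
def IsSegAlloc (num : M.G → ℕ) (len : M.G → ℕ → ℝ) (x : M.G → ℕ → ℝ) : Prop :=
  ∀ j k, 0 ≤ x j k ∧ (k < num j → x j k ≤ len j k) ∧ (num j ≤ k → x j k = 0)

/-- A production plan of firm `f`: amounts of raw goods used on each segment. -/
def IsPlan (f : M.F) (x : M.G → ℕ → ℝ) : Prop :=
  M.IsSegAlloc (M.numP f) (M.o f) x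

/-- Profit of plan `x` of firm `f` at prices `p`. -/
def planProfit (f : M.F) (p : M.G → ℝ) (x : M.G → ℕ → ℝ) : ℝ :=
  ∑ j, ∑ k ∈ Finset.range (M.numP f j), x j k * (M.α f j k * p (M.jf f) - p j)

/-- Amount of good `jf f` produced by plan `x` of firm `f`. -/
def planOutput (f : M.F) (x : M.G → ℕ → ℝ) : ℝ :=
  ∑ j, ∑ k ∈ Finset.range (M.numP f j), M.α f j k * x j k

/-- A profit-maximizing production plan. -/
def OptimalPlan (f : M.F) (p : M.G → ℝ) (x : M.G → ℕ → ℝ) : Prop :=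
  M.IsPlan f x ∧ ∀ x', M.IsPlan f x' → M.planProfit f p x' ≤ M.planProfit f p x

/-- Amount allocated to segment `k` when an amount `t` is filled greedily along
segments of lengths `len 0, len 1, …`. -/
def segAmt (len : ℕ → ℝ) (k : ℕ) (t : ℝ) : ℝ :=
  max 0 (min (len k) (t - ∑ k' ∈ Finset.range k, len k'))

/-- The (separable piecewise-linear concave) utility of agent `i` for bundle `x`. -/
def utilFn (i : M.A) (x : M.G → ℝ) : ℝ :=
  ∑ j, ∑ k ∈ Finset.range (M.numU i j), M.u i j k * segAmt (M.l i j) k (x j)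

/-- Utility of a segment-indexed allocation of agent `i`. -/
def segUtility (i : M.A) (x : M.G → ℕ → ℝ) : ℝ :=
  ∑ j, ∑ k ∈ Finset.range (M.numU i j), M.u i j k * x j k

/-- Cost of bundle `x` at prices `p`. -/
def bundleCost (p : M.G → ℝ) (x : M.G → ℝ) : ℝ := ∑ j, p j * x j

/-- `x` is an optimal (budget-constrained utility-maximizing) bundle for agent `i`. -/
def OptimalBundleAmt (i : M.A) (p : M.G → ℝ) (B : ℝ) (x : M.G → ℝ) : Prop :=
  (∀ j, 0 ≤ x j) ∧ M.bundleCost p x ≤ B ∧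
    ∀ y : M.G → ℝ, (∀ j, 0 ≤ y j) → M.bundleCost p y ≤ B → M.utilFn i y ≤ M.utilFn i x

/-- A segment-indexed optimal bundle for agent `i`: affordable, and its utility is at
least that of any affordable bundle. -/
def OptimalBundle (i : M.A) (p : M.G → ℝ) (B : ℝ) (x : M.G → ℕ → ℝ) : Prop :=
  M.IsSegAlloc (M.numU i) (M.l i) x ∧
  M.bundleCost p (fun j => ∑ k ∈ Finset.range (M.numU i j), x j k) ≤ B ∧
  ∀ y : M.G → ℝ, (∀ j, 0 ≤ y j) → M.bundleCost p y ≤ B → M.utilFn i y ≤ M.segUtility i x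

/-- Budget of agent `i` at prices `p` when firms' (maximum) profits are `E`. -/
def budget (i : M.A) (p : M.G → ℝ) (E : M.F → ℝ) : ℝ :=
  ∑ j, M.w i j * p j + ∑ f, M.θ i f * E f

/-- Market equilibrium: nonnegative prices, profit-maximizing plans (with `E f` the
maximum profit of firm `f`), optimal bundles, and market clearing for every good. -/
def IsEquilibrium (p : M.G → ℝ) (xF : M.F → M.G → ℕ → ℝ) (xA : M.A → M.G → ℕ → ℝ)
    (E : M.F → ℝ) : Prop :=
  (∀ j, 0 ≤ p j) ∧
  (∀ f, M.OptimalPlan f p (xF f) ∧ E f = M.planProfit f p (xF f)) ∧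
  (∀ i, M.OptimalBundle i p (M.budget i p E) (xA i)) ∧
  (∀ j, (∑ i, ∑ k ∈ Finset.range (M.numU i j), xA i j k)
      + (∑ f, ∑ k ∈ Finset.range (M.numP f j), xF f j k)
      = 1 + ∑ f, if M.jf f = j then M.planOutput f (xF f) else 0)

/-- No production out of nothing: along every cyclic sequence of (first segments of)
productions, the rates multiply to strictly less than `1`. -/
def NoProductionOutOfNothing : Prop :=
  ∀ (m : ℕ) (fs : Fin (m + 1) → M.F) (gs : Fin (m + 1) → M.G),
    (∀ t, 0 < M.α (fs t) (gs t) 0) → (∀ t, M.jf (fs t) = gs (t + 1)) →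
    ∏ t, M.α (fs t) (gs t) 0 < 1

/-- Total amount of good `j` represented by agents' segments with positive slope. -/
def desire (j : M.G) : ℝ :=
  ∑ i, ∑ k ∈ (Finset.range (M.numU i j)).filter (fun k => 0 < M.u i j k), M.l i j k

def EnoughDemand : Prop := ∀ j, 1 < M.desire j

/-- A node (agent or firm) possesses/produces good `j`. -/
def owns : M.A ⊕ M.F → M.G → Prop
  | Sum.inl i, j => 0 < M.w i j
  | Sum.inr f, j => M.jf f = j

/-- A node (agent or firm) is non-satiated by good `j`: its last segment for `j`
has positive slope. -/
def nonsat : M.A ⊕ M.F → M.G → Prop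
  | Sum.inl i, j => 0 < M.u i j (M.numU i j - 1)
  | Sum.inr f, j => 0 < M.α f j (M.numP f j - 1)

/-- Edge of the graph `G(M)`. -/
def edge (a b : M.A ⊕ M.F) : Prop := ∃ j, M.owns a j ∧ M.nonsat b j

/-- Strong connectivity: all agent nodes lie in one strongly connected component of `G(M)`. -/
def StrongConnectivity : Prop :=
  ∀ i i' : M.A, Relation.ReflTransGen M.edge (Sum.inl i) (Sum.inl i')

/-- The largest production slope (or `0`). -/
def αmax : ℝ := sSup (insert 0 {x | ∃ f j k, k < M.numP f j ∧ M.α f j k = x})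

/-- The smallest positive production slope. -/
def αminpos : ℝ := sInf {x | 0 < x ∧ ∃ f j k, k < M.numP f j ∧ M.α f j k = x}

/-- The safe bound `L = n^n (α_max + 1)^n`. -/
def Lbig : ℝ :=
  (Fintype.card M.G : ℝ) ^ (Fintype.card M.G) * (M.αmax + 1) ^ (Fintype.card M.G)

/-- Lengths of last segments are fixed to the safe values. -/
def SafeLengths : Prop :=
  (∀ f j, M.o f j (M.numP f j - 1) = M.Lbig / max 1 M.αminpos) ∧
  (∀ i j, M.l i j (M.numU i j - 1) = M.Lbig + 1)

/-- Revenue from production of good `j`: `∑_{f : jf f = j} ∑_{j',k} s^f_{j'k}`,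
where `s^f_{jk} = r^f_{jk} + o^f_{jk} β^f_{jk}`. -/
def prodRevenue (r β : M.F → M.G → ℕ → ℝ) (j : M.G) : ℝ :=
  ∑ f, if M.jf f = j then
      ∑ j', ∑ k ∈ Finset.range (M.numP f j'), (r f j' k + M.o f j' k * β f j' k)
    else 0

/-- The profit `E^f = ∑_{j,k} o^f_{jk} β^f_{jk}` of firm `f` in the LCP. -/
def lcpProfit (β : M.F → M.G → ℕ → ℝ) (f : M.F) : ℝ :=
  ∑ j, ∑ k ∈ Finset.range (M.numP f j), M.o f j k * β f j k

/-- The common core of AD-LCP, NHAD-LCP and NHAD-LCP': all constraints and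
complementarity conditions, with prices `p`, good-clearing complementarity multiplier
`pc`, and `zsub` subtracted in the agents' constraints. -/
def LCPCore (lam : M.A → ℝ) (p pc : M.G → ℝ) (q γ : M.A → M.G → ℕ → ℝ)
    (r β : M.F → M.G → ℕ → ℝ) (zsub : ℝ) : Prop :=
  (∀ i, 0 ≤ lam i) ∧
  (∀ i j k, 0 ≤ q i j k ∧ 0 ≤ γ i j k ∧ (M.numU i j ≤ k → q i j k = 0 ∧ γ i j k = 0)) ∧
  (∀ f j k, 0 ≤ r f j k ∧ 0 ≤ β f j k ∧ (M.numP f j ≤ k → r f j k = 0 ∧ β f j k = 0)) ∧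
  (∀ f j k, k < M.numP f j →
    M.α f j k * p (M.jf f) - p j ≤ β f j k ∧
    r f j k * (M.α f j k * p (M.jf f) - p j - β f j k) = 0) ∧
  (∀ f j k, k < M.numP f j →
    r f j k ≤ M.o f j k * p j ∧ β f j k * (r f j k - M.o f j k * p j) = 0) ∧
  (∀ j, (∑ i, ∑ k ∈ Finset.range (M.numU i j), q i j k)
      + (∑ f, ∑ k ∈ Finset.range (M.numP f j), r f j k)
      ≤ p j + M.prodRevenue r β j ∧
    pc j * ((∑ i, ∑ k ∈ Finset.range (M.numU i j), q i j k)
      + (∑ f, ∑ k ∈ Finset.range (M.numP f j), r f j k)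
      - p j - M.prodRevenue r β j) = 0) ∧
  (∀ i, (∑ j, M.w i j * p j) + (∑ f, M.θ i f * M.lcpProfit β f)
      - (∑ j, ∑ k ∈ Finset.range (M.numU i j), q i j k) - zsub ≤ 0 ∧
    lam i * ((∑ j, M.w i j * p j) + (∑ f, M.θ i f * M.lcpProfit β f)
      - (∑ j, ∑ k ∈ Finset.range (M.numU i j), q i j k) - zsub) = 0) ∧
  (∀ i j k, k < M.numU i j →
    M.u i j k * lam i ≤ p j + γ i j k ∧
    q i j k * (M.u i j k * lam i - p j - γ i j k) = 0) ∧
  (∀ i j k, k < M.numU i j →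
    q i j k ≤ M.l i j k * p j ∧ γ i j k * (q i j k - M.l i j k * p j) = 0)

/-- AD-LCP. -/
def ADLCP (lam : M.A → ℝ) (p : M.G → ℝ) (q γ : M.A → M.G → ℕ → ℝ)
    (r β : M.F → M.G → ℕ → ℝ) : Prop :=
  (∀ j, 0 ≤ p j) ∧ M.LCPCore lam p p q γ r β 0

/-- The vector `c` of price lower bounds: `c j > 1` and no segment has positive
profit at prices `c`. -/
def GoodPriceLB (c : M.G → ℝ) : Prop :=
  (∀ j, 1 < c j) ∧ ∀ f j k, k < M.numP f j → M.α f j k * c (M.jf f) < c j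

/-- NHAD-LCP: AD-LCP with `p j = p' j + c j`, the good-clearing complementarity
multiplier being `p'`. -/
def NHADLCP (c : M.G → ℝ) (lam : M.A → ℝ) (p' : M.G → ℝ) (q γ : M.A → M.G → ℕ → ℝ)
    (r β : M.F → M.G → ℕ → ℝ) : Prop :=
  (∀ j, 0 ≤ p' j) ∧ M.LCPCore lam (fun j => p' j + c j) p' q γ r β 0

/-- NHAD-LCP': NHAD-LCP augmented with the variable `z` in the agents' constraints. -/
def NHADLCP' (c : M.G → ℝ) (lam : M.A → ℝ) (p' : M.G → ℝ) (q γ : M.A → M.G → ℕ → ℝ)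
    (r β : M.F → M.G → ℕ → ℝ) (z : ℝ) : Prop :=
  (∀ j, 0 ≤ p' j) ∧ 0 ≤ z ∧ M.LCPCore lam (fun j => p' j + c j) p' q γ r β z

end SPLCMarket

namespace BoxVI

open MeasureTheory Set Filter Topology

section Perturbation

variable {ι : Type*} [Fintype ι]

lemma exists_polynomial_eval_perturbation (p : MvPolynomial ι ℝ) (x v : ι → ℝ)
    (A : (ι → ℝ) →L[ℝ] (ι → ℝ)) :
    ∃ P : Polynomial ℝ, P.natDegree ≤ p.totalDegree + Fintype.card ι ∧
      ∀ t : ℝ, P.eval t = MvPolynomial.eval (x + t • v) p *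
        (ContinuousLinearMap.id ℝ (ι → ℝ) + t • A).det := by
  set B := LinearMap.toMatrix' (A : (ι → ℝ) →ₗ[ℝ] (ι → ℝ)) with hB
  refine ⟨MvPolynomial.aeval (fun i => Polynomial.C (x i) + Polynomial.X * Polynomial.C (v i)) p *
    ((Polynomial.X : Polynomial ℝ) • B.map Polynomial.C +
      (1 : Matrix ι ι ℝ).map Polynomial.C).det, ?_, fun t => ?_⟩
  · refine Polynomial.natDegree_mul_le.trans (add_le_add ?_ ?_)
    · refine (MvPolynomial.aeval_natDegree_le (n := 1) p le_rfl _ fun i => ?_).trans (by simp)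
      compute_degree
    · exact Polynomial.natDegree_det_X_add_C_le B 1
  · rw [Polynomial.eval_mul]
    congr 1
    · rw [← Polynomial.coe_evalRingHom, MvPolynomial.aeval_def, MvPolynomial.hom_eval₂]
      have : (Polynomial.evalRingHom t).comp (algebraMap ℝ (Polynomial ℝ)) = RingHom.id ℝ := by
        ext; simp
      rw [this, MvPolynomial.eval, MvPolynomial.coe_eval₂Hom]
      congr 1
      ext i
      simp [mul_comm t]
    · rw [← Polynomial.coe_evalRingHom, RingHom.map_det, ContinuousLinearMap.det,
        ← LinearMap.det_toMatrix']
      congr 1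
      ext i j
      by_cases hij : i = j <;>
        simp [hB, LinearMap.toMatrix'_apply, hij, add_comm, mul_comm t]

lemma integral_eq_of_integral_eq_near_zero {E : Type*} [MeasurableSpace E] {μ : Measure E}
    (f : ℝ → E → ℝ) (D : ℕ)
    (hpoly : ∀ x, ∃ P : Polynomial ℝ, P.natDegree ≤ D ∧ ∀ t, P.eval t = f t x)
    (hint : ∀ t, Integrable (f t) μ) {δ C : ℝ} (hδ : 0 < δ)
    (hC : ∀ t, 0 < t → t < δ → ∫ x, f t x ∂μ = C) (s : ℝ) : ∫ x, f s x ∂μ = C := by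
  set node : ℕ → ℝ := fun k => δ / (k + 2) with hnode
  have hpos : ∀ k, 0 < node k := fun k => by positivity
  have hlt : ∀ k, node k < δ := fun k => by
    rw [hnode]
    exact div_lt_self hδ (by linarith [(Nat.cast_nonneg k : (0 : ℝ) ≤ k)])
  have hinj : InjOn node (Finset.range (D + 1)) := by
    intro a _ b _ hab
    simp only [hnode] at hab
    rw [div_eq_div_iff (by positivity) (by positivity)] at hab
    have := mul_left_cancel₀ hδ.ne' hab
    exact_mod_cast (by linarith : (a : ℝ) = b)
  set S := Finset.range (D + 1)
  set L : ℕ → ℝ := fun k => (Lagrange.basis S node k).eval s with hL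
  have hsum : ∑ k ∈ S, L k = 1 := by
    rw [hL, ← Polynomial.eval_finsetSum, Lagrange.sum_basis hinj ⟨0, by simp [S]⟩,
      Polynomial.eval_one]
  have hrep : ∀ x, f s x = ∑ k ∈ S, L k * f (node k) x := by
    intro x
    obtain ⟨P, hdeg, hP⟩ := hpoly x
    have hd : P.degree < S.card := by
      refine Polynomial.degree_le_natDegree.trans_lt ?_
      simp only [S, Finset.card_range]
      exact_mod_cast Nat.lt_succ_of_le hdeg
    conv_lhs => rw [← hP, Lagrange.eq_interpolate hinj hd]
    rw [Lagrange.interpolate_apply, Polynomial.eval_finsetSum]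
    refine Finset.sum_congr rfl fun k _ => ?_
    rw [Polynomial.eval_mul, Polynomial.eval_C, hP]
    ring
  simp_rw [hrep]
  rw [integral_finsetSum _ fun k _ => (hint _).const_mul _]
  simp_rw [integral_const_mul, hC _ (hpos _) (hlt _)]
  rw [← Finset.sum_mul, hsum, one_mul]

lemma exists_pos_forall_det_pos {g : (ι → ℝ) → (ι → ℝ)} {K : NNReal} (hK : LipschitzWith K g) :
    ∃ δ > 0, ∀ t : ℝ, 0 < t → t < δ →
      (t * K < 1 ∧ ∀ x, 0 < (ContinuousLinearMap.id ℝ (ι → ℝ) + t • fderiv ℝ g x).det) := by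
  have hcont : ContinuousAt (fun T : (ι → ℝ) →L[ℝ] (ι → ℝ) => T.det)
      (ContinuousLinearMap.id ℝ (ι → ℝ)) := ContinuousLinearMap.continuous_det.continuousAt
  have h1 : ∀ᶠ T in 𝓝 (ContinuousLinearMap.id ℝ (ι → ℝ)), 0 < T.det := by
    refine hcont.eventually (lt_mem_nhds ?_)
    simp [ContinuousLinearMap.det]
  obtain ⟨η, hη, hball⟩ := Metric.eventually_nhds_iff.1 h1
  refine ⟨min 1 η / (K + 1), by positivity, fun t ht htδ => ?_⟩
  rw [lt_div_iff₀ (by positivity)] at htδ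
  have hm1 : min 1 η ≤ 1 := min_le_left _ _
  have hm2 : min 1 η ≤ η := min_le_right _ _
  refine ⟨by nlinarith, fun x => hball ?_⟩
  rw [dist_eq_norm, add_sub_cancel_left, norm_smul, Real.norm_of_nonneg ht.le]
  have := norm_fderiv_le_of_lipschitz ℝ hK (x₀ := x)
  nlinarith

lemma integral_perturbation_eq {g : (ι → ℝ) → (ι → ℝ)} (hg : ContDiff ℝ 1 g) {R : ℝ}
    (hsupp : ∀ x, x ∉ Metric.closedBall (0 : ι → ℝ) R → g x = 0) (p : MvPolynomial ι ℝ) :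
    ∫ x in Metric.closedBall (0 : ι → ℝ) R, MvPolynomial.eval (x + g x) p *
        (ContinuousLinearMap.id ℝ (ι → ℝ) + fderiv ℝ g x).det =
      ∫ x in Metric.closedBall (0 : ι → ℝ) R, MvPolynomial.eval x p := by
  have hcs : HasCompactSupport g :=
    HasCompactSupport.intro (isCompact_closedBall _ _) hsupp
  obtain ⟨K, hK⟩ := hg.lipschitzWith_of_hasCompactSupport hcs (by simp)
  obtain ⟨δ, hδ, hsmall⟩ := exists_pos_forall_det_pos hK
  have hcp : Continuous fun x : ι → ℝ => MvPolynomial.eval x p := p.continuous_eval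
  have hdiff : Differentiable ℝ g := hg.differentiable (by simp)
  have key := integral_eq_of_integral_eq_near_zero
    (μ := volume.restrict (Metric.closedBall (0 : ι → ℝ) R))
    (fun t x => MvPolynomial.eval (x + t • g x) p *
      (ContinuousLinearMap.id ℝ (ι → ℝ) + t • fderiv ℝ g x).det)
    (p.totalDegree + Fintype.card ι)
    (fun x => exists_polynomial_eval_perturbation p x (g x) (fderiv ℝ g x))
    (fun t => ?_) hδ (C := ∫ x in Metric.closedBall (0 : ι → ℝ) R, MvPolynomial.eval x p)
    (fun t ht htδ => ?_) 1
  · simpa using key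
  · refine ContinuousOn.integrableOn_compact (isCompact_closedBall _ _) (Continuous.continuousOn ?_)
    refine (hcp.comp (continuous_id.add (hg.continuous.const_smul t))).mul ?_
    exact ContinuousLinearMap.continuous_det.comp
      (continuous_const.add ((hg.continuous_fderiv (by simp)).const_smul t))
  · obtain ⟨htK, hdet⟩ := hsmall t ht htδ
    set f : (ι → ℝ) → (ι → ℝ) := fun x => x + t • g x with hf
    have hder : ∀ x, HasFDerivAt f (ContinuousLinearMap.id ℝ (ι → ℝ) + t • fderiv ℝ g x) x :=
      fun x => (hasFDerivAt_id x).add ((hdiff x).hasFDerivAt.const_smul t)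
    have happ : ApproximatesLinearOn f
        ((ContinuousLinearEquiv.refl ℝ (ι → ℝ) : (ι → ℝ) ≃L[ℝ] (ι → ℝ)) : (ι → ℝ) →L[ℝ] (ι → ℝ))
        univ (Real.toNNReal t * K) := by
      rw [ApproximatesLinearOn.approximatesLinearOn_iff_lipschitzOnWith, lipschitzOnWith_univ]
      have : f - ⇑((ContinuousLinearEquiv.refl ℝ (ι → ℝ) : (ι → ℝ) ≃L[ℝ] (ι → ℝ)) :
          (ι → ℝ) →L[ℝ] (ι → ℝ)) = fun x => t • g x := by
        ext x i; simp [hf]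
      rw [this]
      refine LipschitzWith.of_dist_le_mul fun x y => ?_
      rw [dist_smul₀, NNReal.coe_mul, Real.coe_toNNReal _ ht.le, Real.norm_of_nonneg ht.le,
        mul_assoc]
      exact mul_le_mul_of_nonneg_left (hK.dist_le_mul x y) ht.le
    have hc : Subsingleton (ι → ℝ) ∨ Real.toNNReal t * K <
        ‖((ContinuousLinearEquiv.refl ℝ (ι → ℝ)).symm : (ι → ℝ) →L[ℝ] (ι → ℝ))‖₊⁻¹ := by
      rcases subsingleton_or_nontrivial (ι → ℝ) with h | h
      · exact Or.inl h
      · right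
        have h1 : ‖((ContinuousLinearEquiv.refl ℝ (ι → ℝ)).symm :
            (ι → ℝ) →L[ℝ] (ι → ℝ))‖₊ = 1 := by
          rw [ContinuousLinearEquiv.refl_symm, ContinuousLinearEquiv.coe_refl]
          exact NNReal.eq (by simp)
        rw [h1, inv_one, ← NNReal.coe_lt_coe]
        simpa [Real.coe_toNNReal _ ht.le] using htK
    have hinj : Function.Injective f := injOn_univ.1 (happ.injOn hc)
    have hsurj : Function.Surjective f := happ.surjective hc
    have hout : ∀ x, x ∉ Metric.closedBall (0 : ι → ℝ) R → f x = x := fun x hx => by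
      simp [hf, hsupp x hx]
    have himg : f '' Metric.closedBall (0 : ι → ℝ) R = Metric.closedBall (0 : ι → ℝ) R := by
      ext y
      constructor
      · rintro ⟨x, hx, rfl⟩
        by_contra h
        exact h (by rwa [hinj (hout _ h)])
      · intro hy
        obtain ⟨x, rfl⟩ := hsurj y
        refine ⟨x, ?_, rfl⟩
        by_contra h
        exact h (by rwa [hout x h] at hy)
    have := integral_image_eq_integral_abs_det_fderiv_smul volume
      (measurableSet_closedBall (x := (0 : ι → ℝ)) (ε := R))
      (fun x _ => (hder x).hasFDerivWithinAt) hinj.injOn (fun y => MvPolynomial.eval y p)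
    rw [himg] at this
    rw [this]
    refine integral_congr_ae (Eventually.of_forall fun x => ?_)
    simp only [abs_of_pos (hdet x), smul_eq_mul, hf]
    ring

end Perturbation

section FixedPoint

variable {ι : Type*}

lemma exists_mvPolynomial_near {K : Set (ι → ℝ)} (hK : IsCompact K) {ψ : (ι → ℝ) → ℝ}
    (hψ : Continuous ψ) {ε : ℝ} (hε : 0 < ε) :
    ∃ p : MvPolynomial ι ℝ, ∀ x ∈ K, |MvPolynomial.eval x p - ψ x| < ε := by
  have : CompactSpace K := isCompact_iff_compactSpace.1 hK
  set coord : ι → C(K, ℝ) := fun i =>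
    ⟨fun x => x.1 i, (continuous_apply i).comp continuous_subtype_val⟩ with hcoord
  set Φ : MvPolynomial ι ℝ →ₐ[ℝ] C(K, ℝ) := MvPolynomial.aeval coord with hΦ
  have hsep : Φ.range.SeparatesPoints := by
    intro x y hxy
    obtain ⟨i, hi⟩ := Function.ne_iff.1 (Subtype.coe_injective.ne hxy)
    refine ⟨coord i, ⟨coord i, ⟨MvPolynomial.X i, by simp [hΦ]⟩, rfl⟩, hi⟩
  obtain ⟨⟨_, ⟨p, rfl⟩⟩, hp⟩ :=
    ContinuousMap.exists_mem_subalgebra_near_continuous_of_separatesPoints Φ.range hsep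
      (fun x : K => ψ x) (by fun_prop) ε hε
  refine ⟨p, fun x hx => ?_⟩
  have heval : ∀ q, Φ q ⟨x, hx⟩ = MvPolynomial.eval x q := fun q => by
    induction q using MvPolynomial.induction_on with
    | C a => simp [hΦ]
    | add q r hq hr => rw [map_add, map_add, ContinuousMap.add_apply, hq, hr]
    | mul_X q i hq =>
      rw [map_mul, map_mul, ContinuousMap.mul_apply, hq]
      simp [hΦ, hcoord]
  have := hp ⟨x, hx⟩
  rw [Real.norm_eq_abs] at this
  rw [← heval]
  exact this

variable [Fintype ι]

lemma contDiff_mvPolynomial_eval (p : MvPolynomial ι ℝ) :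
    ContDiff ℝ 1 fun x : ι → ℝ => MvPolynomial.eval x p := by
  induction p using MvPolynomial.induction_on with
  | C a => simpa using contDiff_const
  | add p q hp hq => simpa using hp.add hq
  | mul_X p i hp => simpa using hp.mul (contDiff_apply ℝ ℝ i)

lemma exists_add_eq_zero {g : (ι → ℝ) → (ι → ℝ)} (hg : ContDiff ℝ 1 g) {R : ℝ} (hR : 0 < R)
    (hsupp : ∀ x, x ∉ Metric.closedBall (0 : ι → ℝ) R → g x = 0) : ∃ x, x + g x = 0 := by
  by_contra! hne
  set B := Metric.closedBall (0 : ι → ℝ) R with hB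
  have hBc : IsCompact B := isCompact_closedBall _ _
  have hcont : Continuous fun x => x + g x := continuous_id.add hg.continuous
  obtain ⟨x₀, -, hmin⟩ := hBc.exists_isMinOn ⟨0, by simp [hB, hR.le]⟩ hcont.norm.continuousOn
  set δ := min R ‖x₀ + g x₀‖ with hδ
  have hδpos : 0 < δ := lt_min hR (norm_pos_iff.2 (hne x₀))
  set ψ : (ι → ℝ) → ℝ := fun y => max 0 (δ - ‖y‖) with hψ
  have hψc : Continuous ψ := by fun_prop
  have hψ0 : ∀ x ∈ B, ψ (x + g x) = 0 := fun x hx => by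
    have : δ ≤ ‖x + g x‖ := (min_le_right _ _).trans (hmin hx)
    simp [hψ, this]
  have hψout : ∀ x, x ∉ B → ψ x = 0 := fun x hx => by
    have h1 : R < ‖x‖ := by simpa [hB] using hx
    have : δ ≤ ‖x‖ := (min_le_left _ _).trans h1.le
    simp [hψ, this]
  have hpos : 0 < ∫ x in B, ψ x := by
    rw [setIntegral_eq_integral_of_forall_compl_eq_zero hψout]
    refine hψc.integral_pos_of_hasCompactSupport_nonneg_nonzero
      (HasCompactSupport.intro hBc hψout) (fun x => le_max_left _ _) (x := 0) ?_
    simp [hψ, hδpos.not_ge]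
  set J : (ι → ℝ) → ℝ := fun x => (ContinuousLinearMap.id ℝ (ι → ℝ) + fderiv ℝ g x).det with hJ
  have hJc : Continuous J := ContinuousLinearMap.continuous_det.comp
    (continuous_const.add (hg.continuous_fderiv (by simp)))
  have hint : ∀ φ : (ι → ℝ) → ℝ, Continuous φ → IntegrableOn φ B := fun φ hφ =>
    hφ.continuousOn.integrableOn_compact hBc
  set c := (∫ x in B, |J x|) + ∫ x in B, (1 : ℝ) with hc
  have hc0 : 0 ≤ c := add_nonneg (integral_nonneg fun _ => abs_nonneg _)
    (integral_nonneg fun _ => zero_le_one)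
  have hbound : ∀ ε > 0, ∫ x in B, ψ x ≤ ε * c := by
    intro ε hε
    obtain ⟨p, hp⟩ := exists_mvPolynomial_near (hBc.union (hBc.image hcont)) hψc hε
    have hpc : Continuous fun x : ι → ℝ => MvPolynomial.eval x p := p.continuous_eval
    have h1 : ∫ x in B, MvPolynomial.eval (x + g x) p * J x ≤ ∫ x in B, ε * |J x| := by
      refine setIntegral_mono_on (hint _ ((hpc.comp hcont).mul hJc))
        (hint _ (hJc.abs.const_mul ε)) hBc.measurableSet fun x hx => ?_
      have h := hp (x + g x) (Or.inr ⟨x, hx, rfl⟩)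
      rw [hψ0 x hx, sub_zero] at h
      calc _ ≤ |MvPolynomial.eval (x + g x) p * J x| := le_abs_self _
        _ = |MvPolynomial.eval (x + g x) p| * |J x| := abs_mul _ _
        _ ≤ _ := mul_le_mul_of_nonneg_right h.le (abs_nonneg _)
    have h2 : ∫ x in B, ψ x ≤ ∫ x in B, (MvPolynomial.eval x p + ε * 1) := by
      refine setIntegral_mono_on (hint _ hψc) (hint _ (hpc.add continuous_const))
        hBc.measurableSet fun x hx => ?_
      have h := abs_lt.1 (hp x (Or.inl hx))
      linarith
    rw [integral_perturbation_eq hg hsupp p] at h1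
    rw [integral_add (hint _ hpc) (hint _ continuous_const), integral_const_mul] at h2
    rw [integral_const_mul] at h1
    rw [hc, mul_add]
    linarith
  have := hbound ((∫ x in B, ψ x) / (2 * (c + 1))) (by positivity)
  rw [div_mul_eq_mul_div, le_div_iff₀ (by positivity)] at this
  nlinarith

theorem exists_fixedPoint_of_bounded {f : (ι → ℝ) → (ι → ℝ)} (hf : Continuous f) {R : ℝ}
    (hR : ∀ x, ‖f x‖ ≤ R) : ∃ x, f x = x := by
  have hR0 : 0 ≤ R := (norm_nonneg _).trans (hR 0)
  set B := Metric.closedBall (0 : ι → ℝ) (R + 1) with hB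
  have hBc : IsCompact B := isCompact_closedBall _ _
  have happrox : ∀ ε : ℝ, 0 < ε → ε ≤ 1 → ∃ x ∈ B, ‖x - f x‖ ≤ ε := by
    intro ε hε hε1
    have hBc' : IsCompact (Metric.closedBall (0 : ι → ℝ) (R + 2)) := isCompact_closedBall _ _
    choose p hp using fun i : ι => exists_mvPolynomial_near hBc' (ψ := fun x => f x i)
      (by fun_prop) hε
    set P : (ι → ℝ) → (ι → ℝ) := fun x i => MvPolynomial.eval x (p i) with hP
    have hPf : ∀ x ∈ Metric.closedBall (0 : ι → ℝ) (R + 2), ‖P x - f x‖ ≤ ε := fun x hx =>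
      (pi_norm_le_iff_of_nonneg hε.le).2 fun i => (hp i x hx).le
    let χ : ContDiffBump (0 : ι → ℝ) := ⟨R + 1, R + 2, by linarith, by linarith⟩
    have hPd : ContDiff ℝ 1 P := contDiff_pi.2 fun i => contDiff_mvPolynomial_eval (p i)
    obtain ⟨x, hx⟩ := exists_add_eq_zero (g := fun x => -(χ x • P x))
      ((χ.contDiff.smul hPd).neg) (R := R + 2) (by linarith) (fun x hx => by
        have : χ x = 0 := χ.zero_of_le_dist (by
          rw [Metric.mem_closedBall, not_le] at hx; exact hx.le)
        simp [this])
    have hxP : x = χ x • P x := by rwa [add_neg_eq_zero] at hx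
    have hxball : x ∈ Metric.closedBall (0 : ι → ℝ) (R + 2) := by
      by_contra h
      have h0 : χ x = 0 := χ.zero_of_le_dist (by
        rw [Metric.mem_closedBall, not_le] at h; exact h.le)
      rw [h0, zero_smul] at hxP
      rw [hxP] at h
      exact h (by simp; linarith)
    have hPx : ‖P x‖ ≤ R + 1 := by
      have := norm_le_norm_add_norm_sub' (P x) (f x)
      linarith [hPf x hxball, hR x]
    have hxB : x ∈ B := by
      rw [hB, mem_closedBall_zero_iff, hxP, norm_smul, Real.norm_of_nonneg χ.nonneg]
      nlinarith [χ.le_one (x := x), χ.nonneg (x := x), norm_nonneg (P x)]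
    have hone : χ x = 1 := χ.one_of_mem_closedBall hxB
    rw [hone, one_smul] at hxP
    refine ⟨x, hxB, ?_⟩
    have := hPf x hxball
    rwa [← hxP] at this
  obtain ⟨x₀, hx₀, hmin⟩ := hBc.exists_isMinOn ⟨0, by simp [hB]; linarith⟩
    (f := fun x => ‖x - f x‖) (by fun_prop)
  refine ⟨x₀, ?_⟩
  by_contra h
  have hpos : 0 < ‖x₀ - f x₀‖ := norm_pos_iff.2 (sub_ne_zero.2 (Ne.symm h))
  obtain ⟨x, hx, hxe⟩ := happrox (min 1 (‖x₀ - f x₀‖ / 2)) (by positivity) (min_le_left _ _)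
  have h1 : ‖x₀ - f x₀‖ ≤ ‖x - f x‖ := hmin hx
  have h2 := min_le_right 1 (‖x₀ - f x₀‖ / 2)
  linarith

/-- A continuous map on the unit cube admits a solution of the associated box-constrained
variational inequality. -/
theorem exists_box_variational {F : (ι → ℝ) → (ι → ℝ)} (hF : Continuous F) :
    ∃ v : ι → ℝ, ∀ i, 0 ≤ v i ∧ v i ≤ 1 ∧ (v i = 0 ∨ 0 ≤ F v i) ∧ (v i = 1 ∨ F v i ≤ 0) := by
  obtain ⟨x, hx⟩ := exists_fixedPoint_of_bounded
    (f := fun x : ι → ℝ => fun i => max 0 (min 1 (x i + F x i))) (by fun_prop) (R := 1)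
    (fun x => (pi_norm_le_iff_of_nonneg zero_le_one).2 fun i => by
      rw [Real.norm_of_nonneg (le_max_left _ _)]
      exact max_le zero_le_one (min_le_left _ _))
  refine ⟨x, fun i => ?_⟩
  have hi : max 0 (min 1 (x i + F x i)) = x i := congrFun hx i
  refine ⟨hi ▸ le_max_left _ _, hi ▸ max_le zero_le_one (min_le_left _ _), ?_, ?_⟩
  · by_contra! h
    rcases max_choice 0 (min 1 (x i + F x i)) with h1 | h1
    · exact h.1 (by rw [← hi, h1])
    · have := min_le_right 1 (x i + F x i)
      linarith
  · by_contra! h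
    have h1 := le_max_right 0 (min 1 (x i + F x i))
    rcases min_choice 1 (x i + F x i) with h2 | h2
    · have h3 : max 0 (min 1 (x i + F x i)) ≤ 1 := max_le zero_le_one (min_le_left _ _)
      exact h.1 (by linarith)
    · linarith

end FixedPoint

end BoxVI

namespace SPLCMarket

/-- The amount `x` on a segment of length `len` maximizes `d * x`. -/
structure SegOpt (len d x : ℝ) : Prop where
  nonneg : 0 ≤ x
  le : x ≤ len
  eq_zero_or : x = 0 ∨ 0 ≤ d
  eq_len_or : x = len ∨ d ≤ 0

lemma SegOpt.eq_len {len d x : ℝ} (h : SegOpt len d x) (hd : 0 < d) : x = len :=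
  h.eq_len_or.resolve_right hd.not_ge

lemma SegOpt.eq_zero {len d x : ℝ} (h : SegOpt len d x) (hd : d < 0) : x = 0 :=
  h.eq_zero_or.resolve_right hd.not_ge

lemma SegOpt.mul_le {len d x y : ℝ} (h : SegOpt len d x) (hy0 : 0 ≤ y) (hy : y ≤ len) :
    y * d ≤ x * d := by
  rcases lt_trichotomy d 0 with hd | rfl | hd
  · rw [h.eq_zero hd]; nlinarith
  · simp
  · rw [h.eq_len hd]; nlinarith

section Balance

variable (M : SPLCMarket)

/-- Excess demand for good `j`. -/
def excess (x : M.A → M.G → ℕ → ℝ) (y : M.F → M.G → ℕ → ℝ) (j : M.G) : ℝ :=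
  (∑ i, ∑ k ∈ Finset.range (M.numU i j), x i j k)
    + (∑ f, ∑ k ∈ Finset.range (M.numP f j), y f j k)
    - 1 - ∑ f, if M.jf f = j then M.planOutput f (y f) else 0

/-- Unspent budget of agent `i`. -/
def surplus (p : M.G → ℝ) (x : M.A → M.G → ℕ → ℝ) (y : M.F → M.G → ℕ → ℝ) (i : M.A) : ℝ :=
  M.budget i p (fun f => M.planProfit f p (y f))
    - M.bundleCost p (fun j => ∑ k ∈ Finset.range (M.numU i j), x i j k)

lemma planProfit_eq (f : M.F) (p : M.G → ℝ) (y : M.G → ℕ → ℝ) :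
    M.planProfit f p y =
      p (M.jf f) * M.planOutput f y - ∑ j, p j * ∑ k ∈ Finset.range (M.numP f j), y j k := by
  simp only [planProfit, planOutput, Finset.mul_sum, ← Finset.sum_sub_distrib]
  exact Finset.sum_congr rfl fun j _ => Finset.sum_congr rfl fun k _ => by ring

/-- Walras' law. -/
lemma sum_surplus (p : M.G → ℝ) (x : M.A → M.G → ℕ → ℝ) (y : M.F → M.G → ℕ → ℝ) :
    ∑ i, M.surplus p x y i = -∑ j, p j * M.excess x y j := by
  have h1 : ∑ i, ∑ j, M.w i j * p j = ∑ j, p j := by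
    rw [Finset.sum_comm]
    exact Finset.sum_congr rfl fun j _ => by rw [← Finset.sum_mul, M.w_sum, one_mul]
  have h2 : ∑ i, ∑ f, M.θ i f * M.planProfit f p (y f) = ∑ f, M.planProfit f p (y f) := by
    rw [Finset.sum_comm]
    exact Finset.sum_congr rfl fun f _ => by rw [← Finset.sum_mul, M.θ_sum, one_mul]
  have h3 : ∑ j, p j * ∑ f, (if M.jf f = j then M.planOutput f (y f) else 0) =
      ∑ f, p (M.jf f) * M.planOutput f (y f) := by
    simp only [Finset.mul_sum]
    rw [Finset.sum_comm]
    exact Finset.sum_congr rfl fun f _ => by simp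
  have h4 : ∑ i, ∑ j, p j * ∑ k ∈ Finset.range (M.numU i j), x i j k =
      ∑ j, p j * ∑ i, ∑ k ∈ Finset.range (M.numU i j), x i j k := by
    rw [Finset.sum_comm]
    exact Finset.sum_congr rfl fun j _ => by rw [Finset.mul_sum]
  have h5 : ∑ f, ∑ j, p j * ∑ k ∈ Finset.range (M.numP f j), y f j k =
      ∑ j, p j * ∑ f, ∑ k ∈ Finset.range (M.numP f j), y f j k := by
    rw [Finset.sum_comm]
    exact Finset.sum_congr rfl fun j _ => by rw [Finset.mul_sum]
  simp only [surplus, budget, bundleCost, excess, Finset.sum_sub_distrib, Finset.sum_add_distrib,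
    h1, h2, h4, mul_sub, mul_add, h3, mul_one]
  simp only [planProfit_eq, Finset.sum_sub_distrib, h5]
  ring

/-- Nonnegative prices `p` and welfare weights `μ`, at which the allocation `x` maximizes each
agent's weighted utility minus cost and the plans `y` maximize profits, such that all budgets are
exactly spent and the goods markets clear weakly. -/
structure IsWeightedEquilibrium (p : M.G → ℝ) (μ : M.A → ℝ) (x : M.A → M.G → ℕ → ℝ)
    (y : M.F → M.G → ℕ → ℝ) : Prop where
  price_nonneg : ∀ j, 0 ≤ p j
  weight_nonneg : ∀ i, 0 ≤ μ i
  alloc : ∀ i j k, k < M.numU i j → SegOpt (M.l i j k) (μ i * M.u i j k - p j) (x i j k)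
  alloc_zero : ∀ i j k, M.numU i j ≤ k → x i j k = 0
  plan : ∀ f j k, k < M.numP f j →
    SegOpt (M.o f j k) (M.α f j k * p (M.jf f) - p j) (y f j k)
  plan_zero : ∀ f j k, M.numP f j ≤ k → y f j k = 0
  excess_nonpos : ∀ j, M.excess x y j ≤ 0
  price_mul_excess : ∀ j, p j * M.excess x y j = 0
  surplus_eq_zero : ∀ i, M.surplus p x y i = 0

lemma planProfit_nonneg {p : M.G → ℝ} {f : M.F} {y : M.G → ℕ → ℝ}
    (hy : ∀ j k, k < M.numP f j → SegOpt (M.o f j k) (M.α f j k * p (M.jf f) - p j) (y j k)) :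
    0 ≤ M.planProfit f p y :=
  Finset.sum_nonneg fun j _ => Finset.sum_nonneg fun k hk => by
    simpa using (hy j k (Finset.mem_range.1 hk)).mul_le le_rfl
      (M.o_pos f j k (Finset.mem_range.1 hk)).le

lemma budget_nonneg {p : M.G → ℝ} (hp : ∀ j, 0 ≤ p j) {E : M.F → ℝ} (hE : ∀ f, 0 ≤ E f) (i : M.A) :
    0 ≤ M.budget i p E :=
  add_nonneg (Finset.sum_nonneg fun j _ => mul_nonneg (M.w_nonneg i j) (hp j))
    (Finset.sum_nonneg fun f _ => mul_nonneg (M.θ_nonneg i f) (hE f))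

lemma bundleCost_eq_zero_of_weight_eq_zero {p : M.G → ℝ} (hp : ∀ j, 0 ≤ p j) {μ : M.A → ℝ}
    {i : M.A} (hi : μ i = 0) {x : M.G → ℕ → ℝ}
    (hx : ∀ j k, k < M.numU i j → SegOpt (M.l i j k) (μ i * M.u i j k - p j) (x j k)) :
    M.bundleCost p (fun j => ∑ k ∈ Finset.range (M.numU i j), x j k) = 0 := by
  refine Finset.sum_eq_zero fun j _ => ?_
  rcases (hp j).eq_or_lt with h | h
  · rw [← h, zero_mul]
  · dsimp only
    rw [Finset.sum_eq_zero fun k hk => (hx j k (Finset.mem_range.1 hk)).eq_zero (by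
      rw [hi, zero_mul]; linarith), mul_zero]

/-- If the prices and weights solve the box-constrained variational inequality whose components are
the excess demands and surpluses shifted by the normalization error, then that error vanishes. -/
lemma normalization_of_shifted [Nonempty M.A] {p : M.G → ℝ} {μ : M.A → ℝ}
    {x : M.A → M.G → ℕ → ℝ} {y : M.F → M.G → ℕ → ℝ} (hp : ∀ j, 0 ≤ p j) (hμ : ∀ i, 0 ≤ μ i)
    (hx : ∀ i j k, k < M.numU i j → SegOpt (M.l i j k) (μ i * M.u i j k - p j) (x i j k))
    (hy : ∀ f j k, k < M.numP f j →
      SegOpt (M.o f j k) (M.α f j k * p (M.jf f) - p j) (y f j k))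
    {s : ℝ} (hs : s = ∑ j, p j + ∑ i, μ i - 1)
    (hpz : ∀ j, (p j = 0 ∨ 0 ≤ M.excess x y j - s) ∧ (p j = 1 ∨ M.excess x y j - s ≤ 0))
    (hμb : ∀ i, (μ i = 0 ∨ 0 ≤ M.surplus p x y i - s) ∧ (μ i = 1 ∨ M.surplus p x y i - s ≤ 0)) :
    s = 0 ∧ (∀ j, M.excess x y j ≤ 0) ∧ (∀ j, p j * M.excess x y j = 0) ∧
      ∀ i, M.surplus p x y i = 0 := by
  have hwal := M.sum_surplus p x y
  have hp_le : ∀ j, p j ≤ ∑ j, p j := fun j =>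
    Finset.single_le_sum (fun j _ => hp j) (Finset.mem_univ j)
  have hμ_le : ∀ i, μ i ≤ ∑ i, μ i := fun i =>
    Finset.single_le_sum (fun i _ => hμ i) (Finset.mem_univ i)
  have hp_sum : 0 ≤ ∑ j, p j := Finset.sum_nonneg fun j _ => hp j
  have hμ_sum : 0 ≤ ∑ i, μ i := Finset.sum_nonneg fun i _ => hμ i
  have hb0 : 0 ≤ s → ∀ i, 0 ≤ M.surplus p x y i := by
    intro hs0 i
    by_contra! hneg
    have hi : μ i = 0 := (hμb i).1.resolve_right (by linarith)
    have := M.bundleCost_eq_zero_of_weight_eq_zero hp hi (hx i)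
    rw [surplus, this, sub_zero] at hneg
    exact hneg.not_ge (M.budget_nonneg hp (fun f => M.planProfit_nonneg (hy f)) i)
  have hpz0 : ∀ j, s * p j ≤ p j * M.excess x y j := by
    intro j
    rcases (hpz j).1 with h | h
    · simp [h]
    · nlinarith [hp j]
  have hpz_sum : s * ∑ j, p j ≤ ∑ j, p j * M.excess x y j := by
    rw [Finset.mul_sum]
    exact Finset.sum_le_sum fun j _ => hpz0 j
  rcases lt_trichotomy s 0 with hneg | h0 | hpos
  · exfalso
    have hz : ∀ j, M.excess x y j ≤ s := fun j => by
      have := (hpz j).2.resolve_left (by linarith [hp_le j])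
      linarith
    have hb : ∀ i, M.surplus p x y i ≤ s := fun i => by
      have := (hμb i).2.resolve_left (by linarith [hμ_le i])
      linarith
    have h1 : ∑ i, M.surplus p x y i < 0 :=
      Finset.sum_neg (fun i _ => (hb i).trans_lt hneg) Finset.univ_nonempty
    have h2 : ∑ j, p j * M.excess x y j ≤ 0 :=
      Finset.sum_nonpos fun j _ => mul_nonpos_of_nonneg_of_nonpos (hp j) ((hz j).trans hneg.le)
    linarith
  · have hbn := hb0 h0.ge
    have hpzn : ∀ j, 0 ≤ p j * M.excess x y j := fun j => by simpa [h0] using hpz0 j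
    have hbs : 0 ≤ ∑ i, M.surplus p x y i := Finset.sum_nonneg fun i _ => hbn i
    have hpzs : 0 ≤ ∑ j, p j * M.excess x y j := Finset.sum_nonneg fun j _ => hpzn j
    have hpz_eq : ∀ j, p j * M.excess x y j = 0 := fun j =>
      (Finset.sum_eq_zero_iff_of_nonneg fun j _ => hpzn j).1 (by linarith) j (Finset.mem_univ j)
    refine ⟨h0, fun j => ?_, hpz_eq, fun i =>
      (Finset.sum_eq_zero_iff_of_nonneg fun i _ => hbn i).1 (by linarith) i (Finset.mem_univ i)⟩
    rcases (hpz j).2 with h | h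
    · simpa [h] using (hpz_eq j).le
    · simpa [h0] using h
  · exfalso
    have hbn := hb0 hpos.le
    have hbs : 0 ≤ ∑ i, M.surplus p x y i := Finset.sum_nonneg fun i _ => hbn i
    have hps : ∑ j, p j = 0 := by nlinarith
    rw [hps, mul_zero] at hpz_sum
    have hb_eq : ∀ i, M.surplus p x y i = 0 := fun i =>
      (Finset.sum_eq_zero_iff_of_nonneg fun i _ => hbn i).1 (by linarith) i (Finset.mem_univ i)
    have hμ0 : ∑ i, μ i = 0 := Finset.sum_eq_zero fun i _ =>
      (hμb i).1.resolve_right (by linarith [hb_eq i])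
    linarith

theorem exists_isWeightedEquilibrium [Nonempty M.A] :
    ∃ p μ x y, M.IsWeightedEquilibrium p μ x y ∧ ∑ j, p j + ∑ i, μ i = 1 := by
  set K := ∑ i, ∑ j, M.numU i j + ∑ f, ∑ j, M.numP f j with hK
  have hKU : ∀ i j k, k < M.numU i j → k < K + 1 := fun i j k hk => by
    have h1 : M.numU i j ≤ ∑ j, M.numU i j :=
      Finset.single_le_sum (f := fun j => M.numU i j) (fun _ _ => Nat.zero_le _) (Finset.mem_univ j)
    have h2 : ∑ j, M.numU i j ≤ ∑ i, ∑ j, M.numU i j :=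
      Finset.single_le_sum (f := fun i => ∑ j, M.numU i j) (fun _ _ => Nat.zero_le _)
        (Finset.mem_univ i)
    omega
  have hKP : ∀ f j k, k < M.numP f j → k < K + 1 := fun f j k hk => by
    have h1 : M.numP f j ≤ ∑ j, M.numP f j :=
      Finset.single_le_sum (f := fun j => M.numP f j) (fun _ _ => Nat.zero_le _) (Finset.mem_univ j)
    have h2 : ∑ j, M.numP f j ≤ ∑ f, ∑ j, M.numP f j :=
      Finset.single_le_sum (f := fun f => ∑ j, M.numP f j) (fun _ _ => Nat.zero_le _)
        (Finset.mem_univ f)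
    omega
  let ι := (M.G ⊕ M.A) ⊕ ((M.A × M.G × Fin (K + 1)) ⊕ (M.F × M.G × Fin (K + 1)))
  let p : (ι → ℝ) → M.G → ℝ := fun v j => v (Sum.inl (Sum.inl j))
  let μ : (ι → ℝ) → M.A → ℝ := fun v i => v (Sum.inl (Sum.inr i))
  let x : (ι → ℝ) → M.A → M.G → ℕ → ℝ := fun v i j k =>
    (if k < M.numU i j then M.l i j k else 0) * v (Sum.inr (Sum.inl (i, j, Fin.ofNat (K + 1) k)))
  let y : (ι → ℝ) → M.F → M.G → ℕ → ℝ := fun v f j k =>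
    (if k < M.numP f j then M.o f j k else 0) * v (Sum.inr (Sum.inr (f, j, Fin.ofNat (K + 1) k)))
  let s : (ι → ℝ) → ℝ := fun v => ∑ j, p v j + ∑ i, μ v i - 1
  have hpc : ∀ j, Continuous fun v => p v j := fun j => continuous_apply _
  have hμc : ∀ i, Continuous fun v => μ v i := fun i => continuous_apply _
  have hxc : ∀ i j k, Continuous fun v => x v i j k := fun i j k =>
    continuous_const.mul (continuous_apply _)
  have hyc : ∀ f j k, Continuous fun v => y v f j k := fun f j k =>
    continuous_const.mul (continuous_apply _)
  have hsc : Continuous s := by fun_prop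
  have hcont : Continuous fun v : ι → ℝ => (Sum.elim
      (Sum.elim (fun j => M.excess (x v) (y v) j - s v)
        (fun i => M.surplus (p v) (x v) (y v) i - s v))
      (Sum.elim (fun a => μ v a.1 * M.u a.1 a.2.1 a.2.2 - p v a.2.1)
        (fun a => M.α a.1 a.2.1 a.2.2 * p v (M.jf a.1) - p v a.2.1)) : ι → ℝ) := by
    refine continuous_pi ?_
    rintro ((j | i) | (a | a))
    · simp only [Sum.elim_inl, excess, planOutput, ← Finset.sum_filter]
      fun_prop
    · simp only [Sum.elim_inl, Sum.elim_inr, surplus, budget, bundleCost, planProfit]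
      fun_prop
    · simp only [Sum.elim_inl, Sum.elim_inr]
      fun_prop
    · simp only [Sum.elim_inr]
      fun_prop
  obtain ⟨v, hv⟩ := BoxVI.exists_box_variational hcont
  have hp : ∀ j, 0 ≤ p v j := fun j => (hv _).1
  have hμ : ∀ i, 0 ≤ μ v i := fun i => (hv _).1
  have hx : ∀ i j k, k < M.numU i j →
      SegOpt (M.l i j k) (μ v i * M.u i j k - p v j) (x v i j k) := by
    intro i j k hk
    obtain ⟨h0, h1, h2, h3⟩ := hv (Sum.inr (Sum.inl (i, j, Fin.ofNat (K + 1) k)))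
    have hl := M.l_pos i j k hk
    have hmod : ((Fin.ofNat (K + 1) k : Fin (K + 1)) : ℕ) = k := Nat.mod_eq_of_lt (hKU i j k hk)
    simp only [Sum.elim_inl, Sum.elim_inr, hmod] at h2 h3
    have hxe : x v i j k = M.l i j k * v (Sum.inr (Sum.inl (i, j, Fin.ofNat (K + 1) k))) := by
      simp only [x, if_pos hk]
    rw [hxe]
    exact ⟨by positivity, by nlinarith, h2.imp_left fun h => by rw [h, mul_zero],
      h3.imp_left fun h => by rw [h, mul_one]⟩
  have hy : ∀ f j k, k < M.numP f j →
      SegOpt (M.o f j k) (M.α f j k * p v (M.jf f) - p v j) (y v f j k) := by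
    intro f j k hk
    obtain ⟨h0, h1, h2, h3⟩ := hv (Sum.inr (Sum.inr (f, j, Fin.ofNat (K + 1) k)))
    have hl := M.o_pos f j k hk
    have hmod : ((Fin.ofNat (K + 1) k : Fin (K + 1)) : ℕ) = k := Nat.mod_eq_of_lt (hKP f j k hk)
    simp only [Sum.elim_inr, hmod] at h2 h3
    have hye : y v f j k = M.o f j k * v (Sum.inr (Sum.inr (f, j, Fin.ofNat (K + 1) k))) := by
      simp only [y, if_pos hk]
    rw [hye]
    exact ⟨by positivity, by nlinarith, h2.imp_left fun h => by rw [h, mul_zero],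
      h3.imp_left fun h => by rw [h, mul_one]⟩
  obtain ⟨hs, hz, hpz, hb⟩ := M.normalization_of_shifted hp hμ hx hy (s := s v) rfl
    (fun j => (hv (Sum.inl (Sum.inl j))).2.2) (fun i => (hv (Sum.inl (Sum.inr i))).2.2)
  refine ⟨p v, μ v, x v, y v, ⟨hp, hμ, hx, fun i j k hk => ?_, hy, fun f j k hk => ?_, hz, hpz, hb⟩,
    by linarith [show s v = ∑ j, p v j + ∑ i, μ v i - 1 from rfl]⟩
  · simp only [x, if_neg hk.not_gt, zero_mul]
  · simp only [y, if_neg hk.not_gt, zero_mul]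

end Balance

section Potential

variable {M : SPLCMarket}

lemma alpha_zero_nonneg (f : M.F) (j : M.G) : 0 ≤ M.α f j 0 := M.α_nonneg f j 0 (M.numP_pos f j)

lemma alpha_le_alpha_zero (f : M.F) (j : M.G) (k : ℕ) (hk : k < M.numP f j) :
    M.α f j k ≤ M.α f j 0 := by
  induction k with
  | zero => exact le_rfl
  | succ k ih => exact (M.α_anti f j k hk).le.trans (ih (by omega))

lemma finite_alpha : {x | ∃ f j k, k < M.numP f j ∧ M.α f j k = x}.Finite := by
  have : {x | ∃ f j k, k < M.numP f j ∧ M.α f j k = x} =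
      ⋃ f, ⋃ j, M.α f j '' Set.Iio (M.numP f j) := by
    ext; simp
  rw [this]
  exact Set.finite_iUnion fun f => Set.finite_iUnion fun j => (Set.finite_Iio _).image _

lemma bddAbove_alpha : BddAbove (insert 0 {x | ∃ f j k, k < M.numP f j ∧ M.α f j k = x}) :=
  (finite_alpha.insert 0).bddAbove

lemma alpha_le_αmax {f : M.F} {j : M.G} {k : ℕ} (hk : k < M.numP f j) : M.α f j k ≤ M.αmax :=
  le_csSup bddAbove_alpha (Or.inr ⟨f, j, k, hk, rfl⟩)

lemma αmax_nonneg : 0 ≤ M.αmax := le_csSup bddAbove_alpha (Or.inl rfl)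

lemma αminpos_le {f : M.F} {j : M.G} {k : ℕ} (hk : k < M.numP f j) (h : 0 < M.α f j k) :
    M.αminpos ≤ M.α f j k :=
  csInf_le ⟨0, fun _ hx => hx.1.le⟩ ⟨h, f, j, k, hk, rfl⟩

lemma prod_cycle_le_one (hnp : M.NoProductionOutOfNothing) {γ : ℕ → M.G} {φ : ℕ → M.F} {m : ℕ}
    (hstep : ∀ t < m + 1, M.jf (φ t) = γ (t + 1)) (hcyc : γ (m + 1) = γ 0) :
    ∏ t ∈ Finset.range (m + 1), M.α (φ t) (γ t) 0 ≤ 1 := by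
  by_cases hpos : ∀ t < m + 1, 0 < M.α (φ t) (γ t) 0
  · have h := hnp m (fun t => φ t) (fun t => γ t) (fun t => hpos t t.2) (fun t => by
      rw [hstep t t.2, Fin.val_add_one]
      split_ifs with ht
      · rw [ht, Fin.val_last, hcyc]
      · rfl)
    rw [Fin.prod_univ_eq_prod_range (fun t => M.α (φ t) (γ t) 0)] at h
    exact h.le
  · push Not at hpos
    obtain ⟨t, ht, hle⟩ := hpos
    rw [Finset.prod_eq_zero (Finset.mem_range.2 ht) (hle.antisymm (alpha_zero_nonneg _ _))]
    exact zero_le_one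

lemma prod_walk_le (hnp : M.NoProductionOutOfNothing) {b : ℝ} (hb : 1 ≤ b)
    (hα : ∀ f j, M.α f j 0 ≤ b) (T : ℕ) (γ : ℕ → M.G) (φ : ℕ → M.F)
    (hstep : ∀ t < T, M.jf (φ t) = γ (t + 1)) :
    ∏ t ∈ Finset.range T, M.α (φ t) (γ t) 0 ≤ b ^ (Fintype.card M.G - 1) := by
  induction T using Nat.strong_induction_on generalizing γ φ with
  | _ T ih =>
  by_cases hT : T ≤ Fintype.card M.G - 1
  · calc _ ≤ ∏ _t ∈ Finset.range T, b :=
          Finset.prod_le_prod (fun t _ => alpha_zero_nonneg _ _) fun t _ => hα _ _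
      _ = b ^ T := by simp
      _ ≤ _ := pow_le_pow_right₀ hb hT
  · obtain ⟨s, hs, t, ht, hne, heq⟩ := Finset.exists_ne_map_eq_of_card_lt_of_maps_to
      (s := Finset.range (Fintype.card M.G + 1)) (t := (Finset.univ : Finset M.G)) (f := γ)
      (by simp) (fun _ _ => Finset.mem_coe.2 (Finset.mem_univ _))
    rw [Finset.mem_range] at hs ht
    wlog hst : s < t generalizing s t
    · exact this t ht s hs hne.symm heq.symm (by omega)
    obtain ⟨d, rfl⟩ : ∃ d, t = s + (d + 1) := ⟨t - s - 1, by omega⟩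
    obtain ⟨e, rfl⟩ : ∃ e, T = s + (d + 1) + e := ⟨T - (s + (d + 1)), by omega⟩
    have hcycle : ∏ r ∈ Finset.range (d + 1), M.α (φ (s + r)) (γ (s + r)) 0 ≤ 1 :=
      prod_cycle_le_one hnp (γ := fun r => γ (s + r)) (φ := fun r => φ (s + r))
        (fun r hr => by rw [hstep _ (by omega)]; rfl) heq.symm
    have hshort := ih (s + e) (by omega) (fun r => if r < s then γ r else γ (r + (d + 1)))
      (fun r => if r < s then φ r else φ (r + (d + 1))) (fun r hr => by
        by_cases h1 : r + 1 < s
        · simp [h1, (by omega : r < s), hstep r (by omega)]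
        · by_cases h2 : r < s
          · have h3 : r + 1 = s := by omega
            simp only [h2, h1, if_true, if_false]
            rw [hstep r (by omega), h3, heq]
          · simp only [h2, h1, if_false]
            rw [hstep _ (by omega)]
            congr 1
            omega)
    rw [Finset.prod_range_add] at hshort
    rw [Finset.prod_range_add, Finset.prod_range_add]
    have h1 : ∏ r ∈ Finset.range s, M.α (if r < s then φ r else φ (r + (d + 1)))
        (if r < s then γ r else γ (r + (d + 1))) 0 = ∏ r ∈ Finset.range s, M.α (φ r) (γ r) 0 :=
      Finset.prod_congr rfl fun r hr => by simp [Finset.mem_range.1 hr]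
    have h2 : ∏ r ∈ Finset.range e, M.α (if s + r < s then φ (s + r) else φ (s + r + (d + 1)))
        (if s + r < s then γ (s + r) else γ (s + r + (d + 1))) 0 =
        ∏ r ∈ Finset.range e, M.α (φ (s + (d + 1) + r)) (γ (s + (d + 1) + r)) 0 :=
      Finset.prod_congr rfl fun r _ => by
        rw [if_neg (by omega), if_neg (by omega), add_right_comm]
    rw [h1, h2] at hshort
    refine le_trans ?_ hshort
    refine mul_le_mul_of_nonneg_right ?_ (Finset.prod_nonneg fun _ _ => alpha_zero_nonneg _ _)
    exact mul_le_of_le_one_right (Finset.prod_nonneg fun _ _ => alpha_zero_nonneg _ _) hcycle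

/-- Values of the goods, measured by how much of good `j` they can be turned into: no production
increases the value, and the values are bounded. -/
lemma exists_potential (hnp : M.NoProductionOutOfNothing) {b : ℝ} (hb : 1 ≤ b)
    (hα : ∀ f j, M.α f j 0 ≤ b) (j : M.G) :
    ∃ c : M.G → ℝ, (∀ g, 0 ≤ c g) ∧ 1 ≤ c j ∧ (∀ f g, M.α f g 0 * c (M.jf f) ≤ c g) ∧
      ∀ g, c g ≤ b ^ (Fintype.card M.G - 1) := by
  have hb1 : 1 ≤ b ^ (Fintype.card M.G - 1) := one_le_pow₀ hb
  rcases isEmpty_or_nonempty M.F with hF | ⟨⟨f₀⟩⟩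
  · refine ⟨fun g => if g = j then 1 else 0, fun g => ?_, by simp, fun f => isEmptyElim f,
      fun g => ?_⟩ <;> dsimp only <;> split_ifs <;> linarith
  set S : M.G → Set ℝ := fun g => {v | ∃ (T : ℕ) (γ : ℕ → M.G) (φ : ℕ → M.F),
    (∀ t < T, M.jf (φ t) = γ (t + 1)) ∧ γ 0 = g ∧ γ T = j ∧
      v = ∏ t ∈ Finset.range T, M.α (φ t) (γ t) 0} with hS
  have hle : ∀ g, ∀ v ∈ S g, v ≤ b ^ (Fintype.card M.G - 1) := by
    rintro g v ⟨T, γ, φ, hstep, -, -, rfl⟩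
    exact prod_walk_le hnp hb hα T γ φ hstep
  have hbdd : ∀ g, BddAbove (S g) := fun g => ⟨_, hle g⟩
  have hnn : ∀ g, 0 ≤ sSup (S g) := fun g => Real.sSup_nonneg (by
    rintro v ⟨T, γ, φ, -, -, -, rfl⟩
    exact Finset.prod_nonneg fun _ _ => alpha_zero_nonneg _ _)
  refine ⟨fun g => sSup (S g), hnn, ?_, fun f g => ?_, fun g => Real.sSup_le (hle g) (by linarith)⟩
  · exact le_csSup (hbdd j) ⟨0, fun _ => j, fun _ => f₀, by simp, rfl, rfl, by simp⟩
  · dsimp only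
    rw [← smul_eq_mul, ← Real.sSup_smul_of_nonneg (alpha_zero_nonneg f g)]
    refine Real.sSup_le ?_ (hnn g)
    rintro _ ⟨_, ⟨T, γ, φ, hstep, h0, hT, rfl⟩, rfl⟩
    refine le_csSup (hbdd g) ⟨T + 1, fun t => Nat.casesOn t g γ, fun t => Nat.casesOn t f φ, ?_,
      rfl, hT, ?_⟩
    · rintro (_ | t) ht
      · exact h0.symm
      · exact hstep t (by omega)
    · rw [Finset.prod_range_succ', mul_comm]; rfl

variable {p : M.G → ℝ} {μ : M.A → ℝ} {x : M.A → M.G → ℕ → ℝ} {y : M.F → M.G → ℕ → ℝ}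

/-- The value of the free goods that are consumed, or used to produce goods that are not free, is
at most the value of the endowment of free goods. -/
lemma IsWeightedEquilibrium.value_le (h : M.IsWeightedEquilibrium p μ x y) {c : M.G → ℝ}
    (hc : ∀ g, 0 ≤ c g) (hα : ∀ f g, M.α f g 0 * c (M.jf f) ≤ c g) :
    ∑ j with p j = 0, c j * (∑ i, ∑ k ∈ Finset.range (M.numU i j), x i j k +
        ∑ f with 0 < p (M.jf f), ∑ k ∈ Finset.range (M.numP f j), y f j k) ≤
      ∑ j with p j = 0, c j := by
  have hout : ∑ j with p j = 0, c j * ∑ f, (if M.jf f = j then M.planOutput f (y f) else 0) =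
      ∑ f with p (M.jf f) = 0, c (M.jf f) * M.planOutput f (y f) := by
    simp only [Finset.mul_sum, Finset.sum_filter]
    simp only [← Finset.sum_filter]
    rw [Finset.sum_comm]
    rw [Finset.sum_filter]
    refine Finset.sum_congr rfl fun f _ => ?_
    simp [Finset.sum_ite_eq, Finset.mem_filter]
  have hfirm : ∑ f with p (M.jf f) = 0, c (M.jf f) * M.planOutput f (y f) ≤
      ∑ f with p (M.jf f) = 0, ∑ j with p j = 0,
        c j * ∑ k ∈ Finset.range (M.numP f j), y f j k := by
    refine Finset.sum_le_sum fun f hf => ?_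
    have hpf : p (M.jf f) = 0 := (Finset.mem_filter.1 hf).2
    rw [planOutput, Finset.mul_sum, Finset.sum_filter]
    refine Finset.sum_le_sum fun j _ => ?_
    split_ifs with hj
    · rw [Finset.mul_sum, Finset.mul_sum]
      refine Finset.sum_le_sum fun k hk => ?_
      have hk' := Finset.mem_range.1 hk
      have h1 : c (M.jf f) * M.α f j k ≤ c j := by
        have := mul_le_mul_of_nonneg_left (alpha_le_alpha_zero f j k hk') (hc (M.jf f))
        linarith [hα f j]
      rw [← mul_assoc]
      exact mul_le_mul_of_nonneg_right h1 (h.plan f j k hk').nonneg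
    · rw [Finset.sum_eq_zero fun k hk => ?_, mul_zero]
      have hpj : 0 < p j := (h.price_nonneg j).lt_of_ne (Ne.symm hj)
      rw [(h.plan f j k (Finset.mem_range.1 hk)).eq_zero (by rw [hpf]; linarith), mul_zero]
  have hsplit : ∀ j, ∑ f, ∑ k ∈ Finset.range (M.numP f j), y f j k =
      (∑ f with 0 < p (M.jf f), ∑ k ∈ Finset.range (M.numP f j), y f j k) +
        ∑ f with p (M.jf f) = 0, ∑ k ∈ Finset.range (M.numP f j), y f j k := by
    intro j
    rw [← Finset.sum_filter_add_sum_filter_not _ (fun f => 0 < p (M.jf f))]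
    congr 1
    refine Finset.sum_congr (Finset.filter_congr fun f _ => ?_) fun _ _ => rfl
    rw [not_lt]
    exact ⟨fun hf => hf.antisymm (h.price_nonneg _), fun hf => hf.le⟩
  have hexc : ∑ j with p j = 0, c j * M.excess x y j ≤ 0 :=
    Finset.sum_nonpos fun j _ => mul_nonpos_of_nonneg_of_nonpos (hc j) (h.excess_nonpos j)
  have hswap : ∑ j with p j = 0, c j *
      (∑ f with p (M.jf f) = 0, ∑ k ∈ Finset.range (M.numP f j), y f j k) =
      ∑ f with p (M.jf f) = 0, ∑ j with p j = 0,
        c j * ∑ k ∈ Finset.range (M.numP f j), y f j k := by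
    simp only [Finset.mul_sum]
    rw [Finset.sum_comm]
  simp only [excess, hsplit, mul_sub, mul_add, Finset.sum_sub_distrib, Finset.sum_add_distrib,
    hout, hswap, mul_one] at hexc
  simp only [mul_add, Finset.sum_add_distrib]
  linarith

lemma IsWeightedEquilibrium.demand_nonneg (h : M.IsWeightedEquilibrium p μ x y) (i : M.A)
    (j : M.G) : 0 ≤ ∑ k ∈ Finset.range (M.numU i j), x i j k :=
  Finset.sum_nonneg fun k hk => (h.alloc i j k (Finset.mem_range.1 hk)).nonneg

lemma IsWeightedEquilibrium.use_nonneg (h : M.IsWeightedEquilibrium p μ x y) (f : M.F)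
    (j : M.G) : 0 ≤ ∑ k ∈ Finset.range (M.numP f j), y f j k :=
  Finset.sum_nonneg fun k hk => (h.plan f j k (Finset.mem_range.1 hk)).nonneg

lemma IsWeightedEquilibrium.demand_le (h : M.IsWeightedEquilibrium p μ x y)
    (hnp : M.NoProductionOutOfNothing) {j : M.G} (hj : p j = 0) :
    ∑ i, ∑ k ∈ Finset.range (M.numU i j), x i j k +
        ∑ f with 0 < p (M.jf f), ∑ k ∈ Finset.range (M.numP f j), y f j k ≤
      Fintype.card M.G * max 1 M.αmax ^ (Fintype.card M.G - 1) := by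
  obtain ⟨c, hc0, hcj, hcα, hcb⟩ := exists_potential hnp (le_max_left 1 M.αmax)
    (fun f j => (alpha_le_αmax (M.numP_pos f j)).trans (le_max_right _ _)) j
  set D : M.G → ℝ := fun j => ∑ i, ∑ k ∈ Finset.range (M.numU i j), x i j k +
        ∑ f with 0 < p (M.jf f), ∑ k ∈ Finset.range (M.numP f j), y f j k with hD
  have hDnn : ∀ j, 0 ≤ D j := fun j => add_nonneg
    (Finset.sum_nonneg fun i _ => h.demand_nonneg i j) (Finset.sum_nonneg fun f _ => h.use_nonneg f j)
  calc D j ≤ c j * D j := le_mul_of_one_le_left (hDnn j) hcj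
    _ ≤ ∑ j with p j = 0, c j * D j :=
      Finset.single_le_sum (f := fun j => c j * D j) (fun j _ => mul_nonneg (hc0 j) (hDnn j))
        (Finset.mem_filter.2 ⟨Finset.mem_univ j, hj⟩)
    _ ≤ ∑ j with p j = 0, c j := h.value_le hc0 hcα
    _ ≤ ∑ j, c j := Finset.sum_le_sum_of_subset_of_nonneg (Finset.filter_subset _ _)
      fun j _ _ => hc0 j
    _ ≤ ∑ _j : M.G, max 1 M.αmax ^ (Fintype.card M.G - 1) := Finset.sum_le_sum fun j _ => hcb j
    _ = _ := by simp

lemma card_mul_pow_le_Lbig (j : M.G) :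
    Fintype.card M.G * max 1 M.αmax ^ (Fintype.card M.G - 1) * max 1 M.αmax ≤ M.Lbig ∧
      (0 < M.αmax →
        Fintype.card M.G * max 1 M.αmax ^ (Fintype.card M.G - 1) * max 1 M.αmax < M.Lbig) := by
  have hn : 0 < Fintype.card M.G := Fintype.card_pos_iff.2 ⟨j⟩
  have hn1 : (1 : ℝ) ≤ Fintype.card M.G := by exact_mod_cast hn
  have h0 := αmax_nonneg (M := M)
  have hpow : (Fintype.card M.G : ℝ) ≤ (Fintype.card M.G : ℝ) ^ Fintype.card M.G :=
    le_self_pow₀ hn1 hn.ne'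
  rw [mul_assoc, ← pow_succ, Nat.sub_add_cancel hn, Lbig]
  have hm : max 1 M.αmax ≤ M.αmax + 1 := max_le (by linarith) (by linarith)
  refine ⟨by gcongr, fun hpos => ?_⟩
  have hlt : max 1 M.αmax < M.αmax + 1 := max_lt (by linarith) (by linarith)
  have hplt : max 1 M.αmax ^ Fintype.card M.G < (M.αmax + 1) ^ Fintype.card M.G :=
    pow_lt_pow_left₀ hlt (by positivity) hn.ne'
  calc _ < (Fintype.card M.G : ℝ) * (M.αmax + 1) ^ Fintype.card M.G := by gcongr
    _ ≤ _ := by gcongr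

lemma IsWeightedEquilibrium.price_pos_of_agent (h : M.IsWeightedEquilibrium p μ x y)
    (hsafe : M.SafeLengths) (hnp : M.NoProductionOutOfNothing) {i : M.A} {j : M.G}
    (hi : 0 < μ i) (hns : M.nonsat (Sum.inl i) j) : 0 < p j := by
  by_contra hj
  have hj0 : p j = 0 := (not_lt.1 hj).antisymm (h.price_nonneg j)
  have hlast : M.numU i j - 1 < M.numU i j := Nat.sub_lt (M.numU_pos i j) one_pos
  have hx : x i j (M.numU i j - 1) = M.Lbig + 1 := by
    rw [(h.alloc i j _ hlast).eq_len (by rw [hj0, sub_zero]; exact mul_pos hi hns), hsafe.2]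
  have h1 : x i j (M.numU i j - 1) ≤ ∑ k ∈ Finset.range (M.numU i j), x i j k :=
    Finset.single_le_sum (f := fun k => x i j k)
      (fun k hk => (h.alloc i j k (Finset.mem_range.1 hk)).nonneg) (Finset.mem_range.2 hlast)
  have h2 : ∑ k ∈ Finset.range (M.numU i j), x i j k ≤
      ∑ i, ∑ k ∈ Finset.range (M.numU i j), x i j k :=
    Finset.single_le_sum (f := fun i => ∑ k ∈ Finset.range (M.numU i j), x i j k)
      (fun i _ => h.demand_nonneg i j) (Finset.mem_univ i)
  have h3 := h.demand_le hnp hj0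
  have h4 : 0 ≤ ∑ f with 0 < p (M.jf f), ∑ k ∈ Finset.range (M.numP f j), y f j k :=
    Finset.sum_nonneg fun f _ => h.use_nonneg f j
  have h5 : (Fintype.card M.G : ℝ) * max 1 M.αmax ^ (Fintype.card M.G - 1) ≤
      Fintype.card M.G * max 1 M.αmax ^ (Fintype.card M.G - 1) * max 1 M.αmax :=
    le_mul_of_one_le_right (by positivity) (le_max_left _ _)
  linarith [(card_mul_pow_le_Lbig j).1]

lemma IsWeightedEquilibrium.price_pos_of_firm (h : M.IsWeightedEquilibrium p μ x y)
    (hsafe : M.SafeLengths) (hnp : M.NoProductionOutOfNothing) {f : M.F} {j : M.G}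
    (hf : 0 < p (M.jf f)) (hns : M.nonsat (Sum.inr f) j) : 0 < p j := by
  by_contra hj
  have hj0 : p j = 0 := (not_lt.1 hj).antisymm (h.price_nonneg j)
  have hlast : M.numP f j - 1 < M.numP f j := Nat.sub_lt (M.numP_pos f j) one_pos
  have hαpos : 0 < M.α f j (M.numP f j - 1) := hns
  have hαmax : 0 < M.αmax := hαpos.trans_le (alpha_le_αmax hlast)
  have hy : y f j (M.numP f j - 1) = M.Lbig / max 1 M.αminpos := by
    rw [(h.plan f j _ hlast).eq_len (by rw [hj0, sub_zero]; exact mul_pos hαpos hf), hsafe.1]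
  have h1 : y f j (M.numP f j - 1) ≤ ∑ k ∈ Finset.range (M.numP f j), y f j k :=
    Finset.single_le_sum (f := fun k => y f j k)
      (fun k hk => (h.plan f j k (Finset.mem_range.1 hk)).nonneg) (Finset.mem_range.2 hlast)
  have h2 : ∑ k ∈ Finset.range (M.numP f j), y f j k ≤
      ∑ f with 0 < p (M.jf f), ∑ k ∈ Finset.range (M.numP f j), y f j k :=
    Finset.single_le_sum (f := fun f => ∑ k ∈ Finset.range (M.numP f j), y f j k)
      (fun f _ => h.use_nonneg f j) (Finset.mem_filter.2 ⟨Finset.mem_univ f, hf⟩)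
  have h3 := h.demand_le hnp hj0
  have h4 : 0 ≤ ∑ i, ∑ k ∈ Finset.range (M.numU i j), x i j k :=
    Finset.sum_nonneg fun i _ => h.demand_nonneg i j
  have hmin : max 1 M.αminpos ≤ max 1 M.αmax :=
    max_le_max le_rfl ((αminpos_le hlast hαpos).trans (alpha_le_αmax hlast))
  have h5 : M.Lbig / max 1 M.αminpos ≤
      Fintype.card M.G * max 1 M.αmax ^ (Fintype.card M.G - 1) := by linarith
  rw [div_le_iff₀ (by positivity)] at h5
  have h6 : (Fintype.card M.G : ℝ) * max 1 M.αmax ^ (Fintype.card M.G - 1) * max 1 M.αminpos ≤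
      Fintype.card M.G * max 1 M.αmax ^ (Fintype.card M.G - 1) * max 1 M.αmax := by gcongr
  linarith [(card_mul_pow_le_Lbig j).2 hαmax]

lemma IsWeightedEquilibrium.weight_pos_of_owns (h : M.IsWeightedEquilibrium p μ x y) {i : M.A}
    {j : M.G} (hw : 0 < M.w i j) (hj : 0 < p j) : 0 < μ i := by
  refine (h.weight_nonneg i).lt_of_ne fun hi => ?_
  have hb := h.surplus_eq_zero i
  rw [surplus, M.bundleCost_eq_zero_of_weight_eq_zero h.price_nonneg hi.symm (h.alloc i),
    sub_zero, budget] at hb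
  have h1 : M.w i j * p j ≤ ∑ j, M.w i j * p j :=
    Finset.single_le_sum (f := fun j => M.w i j * p j)
      (fun j _ => mul_nonneg (M.w_nonneg i j) (h.price_nonneg j)) (Finset.mem_univ j)
  have h2 : 0 ≤ ∑ f, M.θ i f * M.planProfit f p (y f) := Finset.sum_nonneg fun f _ =>
    mul_nonneg (M.θ_nonneg i f) (M.planProfit_nonneg (h.plan f))
  linarith [mul_pos hw hj]

lemma IsWeightedEquilibrium.weight_pos (h : M.IsWeightedEquilibrium p μ x y)
    (hsum : ∑ j, p j + ∑ i, μ i = 1) (hsafe : M.SafeLengths) (hsc : M.StrongConnectivity)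
    (hnp : M.NoProductionOutOfNothing) (i : M.A) : 0 < μ i := by
  obtain ⟨i₀, hi₀⟩ : ∃ i₀, 0 < μ i₀ := by
    by_contra! hμ
    have hμ0 : ∑ i, μ i = 0 :=
      Finset.sum_eq_zero fun i _ => (hμ i).antisymm (h.weight_nonneg i)
    have hp0 : ∑ j, p j = 0 := Finset.sum_eq_zero fun j _ => by
      by_contra hj
      have hjpos : 0 < p j := (h.price_nonneg j).lt_of_ne (Ne.symm hj)
      obtain ⟨i, -, hi⟩ := Finset.exists_ne_zero_of_sum_ne_zero
        (f := fun i => M.w i j) (s := Finset.univ) (by rw [M.w_sum]; exact one_ne_zero)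
      exact (hμ i).not_gt
        (h.weight_pos_of_owns ((M.w_nonneg i j).lt_of_ne (Ne.symm hi)) hjpos)
    linarith
  have key : ∀ a, Relation.ReflTransGen M.edge a (Sum.inl i₀) →
      Sum.elim (fun i => 0 < μ i) (fun f => 0 < p (M.jf f)) a := by
    intro a ha
    induction ha using Relation.ReflTransGen.head_induction_on with
    | refl => exact hi₀
    | @head a b hab _ hb =>
      obtain ⟨j, hown, hns⟩ := hab
      have hj : 0 < p j := by
        rcases b with i | f
        · exact h.price_pos_of_agent hsafe hnp hb hns
        · exact h.price_pos_of_firm hsafe hnp hb hns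
      rcases a with i | f
      · exact h.weight_pos_of_owns hown hj
      · have hjf : M.jf f = j := hown
        rw [Sum.elim_inr, hjf]
        exact hj
  exact key (Sum.inl i) (hsc i i₀)

lemma IsWeightedEquilibrium.price_pos (h : M.IsWeightedEquilibrium p μ x y) (hμ : ∀ i, 0 < μ i)
    (hnp : M.NoProductionOutOfNothing) (hdem : M.EnoughDemand) (j : M.G) : 0 < p j := by
  by_contra hj
  have hj0 : p j = 0 := (not_lt.1 hj).antisymm (h.price_nonneg j)
  choose c hc0 hcj hcα _ using fun j => exists_potential hnp (le_max_left 1 M.αmax)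
    (fun f j => (alpha_le_αmax (M.numP_pos f j)).trans (le_max_right _ _)) j
  have hval := h.value_le (c := fun g => ∑ j, c j g)
    (fun g => Finset.sum_nonneg fun j _ => hc0 j g) (fun f g => by
      rw [Finset.mul_sum]
      exact Finset.sum_le_sum fun j _ => hcα j f g)
  refine hval.not_gt (Finset.sum_lt_sum_of_nonempty ⟨j, by simpa using hj0⟩ fun g hg => ?_)
  have hg0 : p g = 0 := (Finset.mem_filter.1 hg).2
  have hcpos : 0 < ∑ j, c j g := zero_lt_one.trans_le ((hcj g).trans
    (Finset.single_le_sum (f := fun j => c j g) (fun j _ => hc0 j g) (Finset.mem_univ g)))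
  refine lt_mul_of_one_lt_right hcpos ((hdem g).trans_le ?_)
  refine le_add_of_le_of_nonneg ?_ (Finset.sum_nonneg fun f _ => h.use_nonneg f g)
  refine Finset.sum_le_sum fun i _ => ?_
  rw [Finset.sum_filter]
  refine Finset.sum_le_sum fun k hk => ?_
  have hk' := Finset.mem_range.1 hk
  split_ifs with hu
  · exact ((h.alloc i g k hk').eq_len (by rw [hg0, sub_zero]; exact mul_pos (hμ i) hu)).ge
  · exact (h.alloc i g k hk').nonneg

end Potential

end SPLCMarket

/-- Finitely many real numbers have their signs preserved by some `ℚ`-linear map with rational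
values. -/
lemma exists_rational_linearMap_sign (T : Set ℝ) (hT : T.Finite) :
    ∃ ψ : ℝ →ₗ[ℚ] ℝ, (∀ t, ∃ a : ℚ, ψ t = a) ∧
      ∀ t ∈ T, (0 < t → 0 < ψ t) ∧ (t < 0 → ψ t < 0) := by
  have := FiniteDimensional.span_of_finite ℚ hT
  set W := Submodule.span ℚ T
  let b := Module.finBasis ℚ W
  have hmem : ∀ t ∈ T, t ∈ W := fun t ht => Submodule.subset_span ht
  let F : W → (Fin (Module.finrank ℚ W) → ℝ) → ℝ := fun t v => ∑ i, (b.repr t i : ℝ) * v i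
  have hF : ∀ t : W, F t (fun i => (b i : ℝ)) = t := fun t => by
    simpa [F, -Module.Basis.sum_repr, Rat.smul_def] using congrArg W.subtype (b.sum_repr t)
  have hFc : ∀ t, Continuous (F t) := fun t => by fun_prop
  have hopen : ∀ᶠ v in nhds (fun i => (b i : ℝ)),
      ∀ t ∈ (Subtype.val ⁻¹' T : Set W), (0 < (t : ℝ) → 0 < F t v) ∧ ((t : ℝ) < 0 → F t v < 0) := by
    rw [(hT.preimage Subtype.val_injective.injOn).eventually_all]
    refine fun t _ => Filter.Eventually.and ?_ ?_
    · by_cases h : 0 < (t : ℝ)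
      · rw [← hF t] at h
        filter_upwards [(hFc t).continuousAt.eventually (lt_mem_nhds h)] with v hv _ using hv
      · simp [h]
    · by_cases h : (t : ℝ) < 0
      · rw [← hF t] at h
        filter_upwards [(hFc t).continuousAt.eventually (gt_mem_nhds h)] with v hv _ using hv
      · simp [h]
  have hdense : DenseRange fun (q : Fin (Module.finrank ℚ W) → ℚ) i => (q i : ℝ) :=
    DenseRange.piMap fun _ => Rat.denseRange_cast
  obtain ⟨_, ⟨q, rfl⟩, hq⟩ :=
    ((mem_closure_iff_frequently.1 (hdense _)).and_eventually hopen).exists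
  obtain ⟨ψ, hψ⟩ := (b.constr ℚ q).exists_extend
  refine ⟨Algebra.linearMap ℚ ℝ ∘ₗ ψ, fun t => ⟨ψ t, rfl⟩, fun t ht => ?_⟩
  have hval : (Algebra.linearMap ℚ ℝ ∘ₗ ψ) t = F ⟨t, hmem t ht⟩ fun i => (q i : ℝ) := by
    have : ψ t = b.constr ℚ q ⟨t, hmem t ht⟩ := by rw [← hψ]; rfl
    simp [F, this, Module.Basis.constr_apply_fintype]
  rw [hval]
  exact hq ⟨t, hmem t ht⟩ ht

namespace SPLCMarket

lemma map_ratCast_mul (ψ : ℝ →ₗ[ℚ] ℝ) (a : ℚ) (t : ℝ) : ψ (a * t) = a * ψ t := by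
  rw [← Rat.smul_def, map_smul, Rat.smul_def]

/-- Quantities are transported along `ψ` through their value at price `p`. -/
lemma SegOpt.map {ψ : ℝ →ₗ[ℚ] ℝ} {a : ℚ} {d x p : ℝ} (h : SegOpt a d x) (hp : 0 < p)
    (hψp : 0 < ψ p) (hx : 0 < x * p → 0 < ψ (x * p))
    (hax : 0 < (a - x) * p → 0 < ψ ((a - x) * p)) (hd : (0 < d → 0 < ψ d) ∧ (d < 0 → ψ d < 0)) :
    SegOpt a (ψ d) (ψ (x * p) / ψ p) ∧ ψ (x * d) = ψ (x * p) / ψ p * ψ d := by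
  have hlen : x = a → ψ (x * p) / ψ p = a := by
    rintro rfl
    rw [map_ratCast_mul, mul_div_cancel_right₀ _ hψp.ne']
  have hzero : x = 0 → ψ (x * p) / ψ p = 0 := by
    rintro rfl
    simp
  refine ⟨⟨?_, ?_, ?_, ?_⟩, ?_⟩
  · rcases h.nonneg.eq_or_lt with h0 | h0
    · exact (hzero h0.symm).ge
    · exact div_nonneg (hx (mul_pos h0 hp)).le hψp.le
  · rcases h.le.eq_or_lt with h0 | h0
    · exact (hlen h0).le
    · have := hax (mul_pos (sub_pos.2 h0) hp)
      rw [sub_mul, map_sub, map_ratCast_mul] at this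
      rw [div_le_iff₀ hψp]
      linarith
  · refine h.eq_zero_or.imp hzero fun h0 => ?_
    rcases h0.eq_or_lt with h0 | h0
    · simp [← h0]
    · exact (hd.1 h0).le
  · refine h.eq_len_or.imp hlen fun h0 => ?_
    rcases h0.eq_or_lt with h0 | h0
    · simp [h0]
    · exact (hd.2 h0).le
  · rcases lt_trichotomy d 0 with h0 | rfl | h0
    · rw [hzero (h.eq_zero h0), h.eq_zero h0]; simp
    · simp
    · rw [hlen (h.eq_len h0), h.eq_len h0, map_ratCast_mul]

lemma segAmt_nonneg (len : ℕ → ℝ) (k : ℕ) (t : ℝ) : 0 ≤ segAmt len k t := le_max_left _ _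

lemma segAmt_le {len : ℕ → ℝ} {k : ℕ} (h : 0 ≤ len k) (t : ℝ) : segAmt len k t ≤ len k :=
  max_le h (min_le_left _ _)

lemma sum_segAmt {len : ℕ → ℝ} {n : ℕ} (hlen : ∀ k < n, 0 ≤ len k) {t : ℝ} (ht : 0 ≤ t) :
    ∑ k ∈ Finset.range n, segAmt len k t = min t (∑ k ∈ Finset.range n, len k) := by
  induction n with
  | zero => simp [ht]
  | succ n ih =>
    have hn := hlen n n.lt_succ_self
    rw [Finset.sum_range_succ, Finset.sum_range_succ,
      ih fun k hk => hlen k (hk.trans n.lt_succ_self), segAmt]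
    set s := ∑ k ∈ Finset.range n, len k
    rcases le_total t s with h | h
    · rw [min_eq_left h, min_eq_left (h.trans (le_add_of_nonneg_right hn)), max_eq_left, add_zero]
      exact (min_le_right _ _).trans (sub_nonpos.2 h)
    · rw [min_eq_right h, max_eq_right (le_min hn (sub_nonneg.2 h)), add_comm, ← min_add_add_right,
        sub_add_cancel, add_comm, min_comm]

lemma sum_segAmt_le {len : ℕ → ℝ} {n : ℕ} (hlen : ∀ k < n, 0 ≤ len k) {t : ℝ} (ht : 0 ≤ t) :
    ∑ k ∈ Finset.range n, segAmt len k t ≤ t :=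
  (sum_segAmt hlen ht).trans_le (min_le_left _ _)

variable {M : SPLCMarket} {p : M.G → ℝ} {μ : M.A → ℝ} {x : M.A → M.G → ℕ → ℝ}
  {y : M.F → M.G → ℕ → ℝ}

lemma IsWeightedEquilibrium.optimalPlan (h : M.IsWeightedEquilibrium p μ x y) (f : M.F) :
    M.OptimalPlan f p (y f) := by
  refine ⟨fun j k => ?_, fun x' hx' => ?_⟩
  · rcases lt_or_ge k (M.numP f j) with hk | hk
    · exact ⟨(h.plan f j k hk).nonneg, fun _ => (h.plan f j k hk).le, fun hk' => by omega⟩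
    · exact ⟨(h.plan_zero f j k hk).ge, fun hk' => by omega, fun _ => h.plan_zero f j k hk⟩
  · refine Finset.sum_le_sum fun j _ => Finset.sum_le_sum fun k hk => ?_
    have hk := Finset.mem_range.1 hk
    exact (h.plan f j k hk).mul_le (hx' j k).1 ((hx' j k).2.1 hk)

lemma sum_mul_marginal (i : M.A) (z : M.G → ℕ → ℝ) :
    ∑ j, ∑ k ∈ Finset.range (M.numU i j), z j k * (μ i * M.u i j k - p j) =
      μ i * M.segUtility i z - ∑ j, p j * ∑ k ∈ Finset.range (M.numU i j), z j k := by
  simp only [segUtility, Finset.mul_sum, ← Finset.sum_sub_distrib]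
  exact Finset.sum_congr rfl fun j _ => Finset.sum_congr rfl fun k _ => by ring

lemma IsWeightedEquilibrium.optimalBundle (h : M.IsWeightedEquilibrium p μ x y) {i : M.A}
    (hμ : 0 < μ i) :
    M.OptimalBundle i p (M.budget i p fun f => M.planProfit f p (y f)) (x i) := by
  have hcost := h.surplus_eq_zero i
  rw [surplus, sub_eq_zero] at hcost
  refine ⟨fun j k => ?_, hcost.ge, fun z hz hzB => ?_⟩
  · rcases lt_or_ge k (M.numU i j) with hk | hk
    · exact ⟨(h.alloc i j k hk).nonneg, fun _ => (h.alloc i j k hk).le, fun hk' => by omega⟩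
    · exact ⟨(h.alloc_zero i j k hk).ge, fun hk' => by omega, fun _ => h.alloc_zero i j k hk⟩
  · have hl : ∀ j, ∀ k < M.numU i j, 0 ≤ M.l i j k := fun j k hk => (M.l_pos i j k hk).le
    have hle : ∑ j, ∑ k ∈ Finset.range (M.numU i j),
          segAmt (M.l i j) k (z j) * (μ i * M.u i j k - p j) ≤
        ∑ j, ∑ k ∈ Finset.range (M.numU i j), x i j k * (μ i * M.u i j k - p j) :=
      Finset.sum_le_sum fun j _ => Finset.sum_le_sum fun k hk =>
        (h.alloc i j k (Finset.mem_range.1 hk)).mul_le (segAmt_nonneg _ _ _)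
          (segAmt_le (hl j k (Finset.mem_range.1 hk)) _)
    rw [sum_mul_marginal i (fun j k => segAmt (M.l i j) k (z j)), sum_mul_marginal] at hle
    have hseg : ∑ j, p j * ∑ k ∈ Finset.range (M.numU i j), segAmt (M.l i j) k (z j) ≤
        M.bundleCost p z :=
      Finset.sum_le_sum fun j _ =>
        mul_le_mul_of_nonneg_left (sum_segAmt_le (hl j) (hz j)) (h.price_nonneg j)
    rw [hcost] at hzB
    exact le_of_mul_le_mul_left (a := μ i)
      (by simp only [bundleCost, segUtility, utilFn] at *; linarith) hμ

lemma IsWeightedEquilibrium.isEquilibrium (h : M.IsWeightedEquilibrium p μ x y)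
    (hp : ∀ j, 0 < p j) (hμ : ∀ i, 0 < μ i) :
    M.IsEquilibrium p y x (fun f => M.planProfit f p (y f)) := by
  refine ⟨h.price_nonneg, fun f => ⟨h.optimalPlan f, rfl⟩, fun i => h.optimalBundle (hμ i),
    fun j => ?_⟩
  have := (mul_eq_zero.1 (h.price_mul_excess j)).resolve_left (hp j).ne'
  rw [excess] at this
  linarith

lemma IsWeightedEquilibrium.exists_rational (h : M.IsWeightedEquilibrium p μ x y)
    (hp : ∀ j, 0 < p j) (hμ : ∀ i, 0 < μ i)
    (hw : ∀ i j, ∃ a : ℚ, M.w i j = (a : ℝ))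
    (hθ : ∀ i f, ∃ a : ℚ, M.θ i f = (a : ℝ))
    (hu : ∀ i j k, k < M.numU i j → ∃ a : ℚ, M.u i j k = (a : ℝ))
    (hl : ∀ i j k, k < M.numU i j → ∃ a : ℚ, M.l i j k = (a : ℝ))
    (hα : ∀ f j k, k < M.numP f j → ∃ a : ℚ, M.α f j k = (a : ℝ))
    (ho : ∀ f j k, k < M.numP f j → ∃ a : ℚ, M.o f j k = (a : ℝ)) :
    ∃ p' μ' x' y', M.IsWeightedEquilibrium p' μ' x' y' ∧ (∀ j, 0 < p' j) ∧ (∀ i, 0 < μ' i) ∧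
      (∀ j, ∃ a : ℚ, p' j = (a : ℝ)) ∧ (∀ i j k, ∃ a : ℚ, x' i j k = (a : ℝ)) ∧
      (∀ f j k, ∃ a : ℚ, y' f j k = (a : ℝ)) := by
  let TA : ∀ i j, Fin (M.numU i j) → Set ℝ := fun i j k =>
    {x i j k * p j, (M.l i j k - x i j k) * p j, μ i * M.u i j k - p j}
  let TF : ∀ f j, Fin (M.numP f j) → Set ℝ := fun f j k =>
    {y f j k * p j, (M.o f j k - y f j k) * p j, M.α f j k * p (M.jf f) - p j}
  have hfin : (Set.range p ∪ Set.range μ ∪ (⋃ i, ⋃ j, ⋃ k, TA i j k) ∪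
      ⋃ f, ⋃ j, ⋃ k, TF f j k).Finite := Set.toFinite _
  obtain ⟨ψ, hψ, hsign⟩ := exists_rational_linearMap_sign _ hfin
  have hp' : ∀ j, 0 < ψ (p j) := fun j =>
    (hsign _ (Or.inl (Or.inl (Or.inl ⟨j, rfl⟩)))).1 (hp j)
  have hμ' : ∀ i, 0 < ψ (μ i) := fun i =>
    (hsign _ (Or.inl (Or.inl (Or.inr ⟨i, rfl⟩)))).1 (hμ i)
  have hTA : ∀ i j k, k < M.numU i j →
      ∀ t ∈ ({x i j k * p j, (M.l i j k - x i j k) * p j, μ i * M.u i j k - p j} : Set ℝ),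
        (0 < t → 0 < ψ t) ∧ (t < 0 → ψ t < 0) := fun i j k hk t ht =>
    hsign t (Or.inl (Or.inr (Set.mem_iUnion.2 ⟨i, Set.mem_iUnion.2 ⟨j, Set.mem_iUnion.2
      ⟨⟨k, hk⟩, ht⟩⟩⟩)))
  have hTF : ∀ f j k, k < M.numP f j →
      ∀ t ∈ ({y f j k * p j, (M.o f j k - y f j k) * p j, M.α f j k * p (M.jf f) - p j} : Set ℝ),
        (0 < t → 0 < ψ t) ∧ (t < 0 → ψ t < 0) := fun f j k hk t ht =>
    hsign t (Or.inr (Set.mem_iUnion.2 ⟨f, Set.mem_iUnion.2 ⟨j, Set.mem_iUnion.2 ⟨⟨k, hk⟩, ht⟩⟩⟩))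
  let x' : M.A → M.G → ℕ → ℝ := fun i j k => ψ (x i j k * p j) / ψ (p j)
  let y' : M.F → M.G → ℕ → ℝ := fun f j k => ψ (y f j k * p j) / ψ (p j)
  have hxp : ∀ i j k, ψ (p j * x i j k) = ψ (p j) * x' i j k := fun i j k => by
    rw [mul_comm (p j), mul_div_cancel₀ _ (hp' j).ne']
  have hyp : ∀ f j k, ψ (p j * y f j k) = ψ (p j) * y' f j k := fun f j k => by
    rw [mul_comm (p j), mul_div_cancel₀ _ (hp' j).ne']
  have halloc : ∀ i j k, k < M.numU i j →
      SegOpt (M.l i j k) (ψ (μ i) * M.u i j k - ψ (p j)) (x' i j k) := by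
    intro i j k hk
    obtain ⟨a, ha⟩ := hl i j k hk
    obtain ⟨c, hc⟩ := hu i j k hk
    have hs := h.alloc i j k hk
    have hT := hTA i j k hk
    have hd : ψ (μ i * M.u i j k - p j) = ψ (μ i) * M.u i j k - ψ (p j) := by
      rw [map_sub, hc, mul_comm, map_ratCast_mul, mul_comm]
    rw [ha] at hs hT
    rw [← hd, ha]
    exact (hs.map (hp j) (hp' j) (hT _ (by simp)).1 (hT _ (by simp)).1 (hT _ (by simp))).1
  have hplan : ∀ f j k, k < M.numP f j →
      SegOpt (M.o f j k) (M.α f j k * ψ (p (M.jf f)) - ψ (p j)) (y' f j k) ∧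
        ψ (y f j k * (M.α f j k * p (M.jf f) - p j)) =
          y' f j k * (M.α f j k * ψ (p (M.jf f)) - ψ (p j)) := by
    intro f j k hk
    obtain ⟨a, ha⟩ := ho f j k hk
    obtain ⟨c, hc⟩ := hα f j k hk
    have hs := h.plan f j k hk
    have hT := hTF f j k hk
    have hd : ψ (M.α f j k * p (M.jf f) - p j) = M.α f j k * ψ (p (M.jf f)) - ψ (p j) := by
      rw [map_sub, hc, map_ratCast_mul]
    rw [ha] at hs hT
    rw [← hd, ha]
    exact hs.map (hp j) (hp' j) (hT _ (by simp)).1 (hT _ (by simp)).1 (hT _ (by simp))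
  have hprofit : ∀ f, ψ (M.planProfit f p (y f)) = M.planProfit f (fun j => ψ (p j)) (y' f) := by
    intro f
    simp only [planProfit, map_sum]
    exact Finset.sum_congr rfl fun j _ => Finset.sum_congr rfl fun k hk =>
      (hplan f j k (Finset.mem_range.1 hk)).2
  have hrevenue : ∀ f, ψ (p (M.jf f) * M.planOutput f (y f)) =
      ψ (p (M.jf f)) * M.planOutput f (y' f) := by
    intro f
    have := hprofit f
    simp only [planProfit_eq, map_sub, Finset.mul_sum, map_sum, hyp] at this
    exact sub_left_injective this
  have hexcess : ∀ j, ψ (p j * M.excess x y j) = ψ (p j) * M.excess x' y' j := by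
    intro j
    simp only [excess, mul_sub, mul_add, Finset.mul_sum, map_sub, map_add, map_sum, hxp, hyp,
      mul_one]
    congr 1
    refine Finset.sum_congr rfl fun f _ => ?_
    split_ifs with hf
    · rw [← hf, hrevenue]
    · simp
  have hsurplus : ∀ i, ψ (M.surplus p x y i) = M.surplus (fun j => ψ (p j)) x' y' i := by
    intro i
    simp only [surplus, budget, bundleCost, Finset.mul_sum, map_sub, map_add, map_sum, hxp]
    congr 2
    · refine Finset.sum_congr rfl fun j _ => ?_
      obtain ⟨a, ha⟩ := hw i j
      rw [ha, map_ratCast_mul]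
    · refine Finset.sum_congr rfl fun f _ => ?_
      obtain ⟨a, ha⟩ := hθ i f
      rw [ha, map_ratCast_mul, hprofit]
  have hexcess_zero : ∀ j, M.excess x' y' j = 0 := fun j => by
    have := hexcess j
    rw [h.price_mul_excess, map_zero, eq_comm] at this
    exact (mul_eq_zero.1 this).resolve_left (hp' j).ne'
  have hrat : ∀ s t, ∃ a : ℚ, ψ s / ψ t = a := fun s t => by
    obtain ⟨a, ha⟩ := hψ s
    obtain ⟨b, hb⟩ := hψ t
    exact ⟨a / b, by rw [ha, hb]; push_cast; rfl⟩
  exact ⟨fun j => ψ (p j), fun i => ψ (μ i), x', y',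
    ⟨fun j => (hp' j).le, fun i => (hμ' i).le, halloc,
      fun i j k hk => by simp [x', h.alloc_zero i j k hk], fun f j k hk => (hplan f j k hk).1,
      fun f j k hk => by simp [y', h.plan_zero f j k hk], fun j => (hexcess_zero j).le,
      fun j => by rw [hexcess_zero, mul_zero],
      fun i => by rw [← hsurplus, h.surplus_eq_zero, map_zero]⟩,
    hp', hμ', fun j => hψ _, fun i j k => hrat _ _, fun f j k => hrat _ _⟩

end SPLCMarket

/-- If all parameters of the SPLC market `M` are rational and `M` satisfies strong
connectivity, no production out of nothing, and enough demand, then `M` admits a market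
equilibrium in which all prices, allocation amounts and production amounts are rational. -/
theorem stmt5 (M : SPLCMarket) (hsafe : M.SafeLengths)
    (hsc : M.StrongConnectivity) (hnp : M.NoProductionOutOfNothing) (hdem : M.EnoughDemand)
    (hw : ∀ i j, ∃ a : ℚ, M.w i j = (a : ℝ))
    (hθ : ∀ i f, ∃ a : ℚ, M.θ i f = (a : ℝ))
    (hu : ∀ i j k, k < M.numU i j → ∃ a : ℚ, M.u i j k = (a : ℝ))
    (hl : ∀ i j k, k < M.numU i j → ∃ a : ℚ, M.l i j k = (a : ℝ))
    (hα : ∀ f j k, k < M.numP f j → ∃ a : ℚ, M.α f j k = (a : ℝ))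
    (ho : ∀ f j k, k < M.numP f j → ∃ a : ℚ, M.o f j k = (a : ℝ)) :
    ∃ (p : M.G → ℝ) (xF : M.F → M.G → ℕ → ℝ) (xA : M.A → M.G → ℕ → ℝ) (E : M.F → ℝ),
      M.IsEquilibrium p xF xA E ∧
      (∀ j, ∃ a : ℚ, p j = (a : ℝ)) ∧
      (∀ i j k, ∃ a : ℚ, xA i j k = (a : ℝ)) ∧
      (∀ f j k, ∃ a : ℚ, xF f j k = (a : ℝ)) := by
  rcases isEmpty_or_nonempty M.A with hA | hA
  · have hG : IsEmpty M.G := ⟨fun j => by simpa using M.w_sum j⟩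
    have hF : IsEmpty M.F := ⟨fun f => hG.elim (M.jf f)⟩
    exact ⟨isEmptyElim, isEmptyElim, isEmptyElim, isEmptyElim,
      ⟨isEmptyElim, isEmptyElim, isEmptyElim, isEmptyElim⟩,
      isEmptyElim, isEmptyElim, isEmptyElim⟩
  · obtain ⟨p, μ, x, y, h, hsum⟩ := M.exists_isWeightedEquilibrium
    have hμ := h.weight_pos hsum hsafe hsc hnp
    obtain ⟨p', μ', x', y', h', hp', hμ', hprat, hxrat, hyrat⟩ :=
      h.exists_rational (h.price_pos hμ hnp hdem) hμ hw hθ hu hl hα ho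
    exact ⟨p', y', x', _, h'.isEquilibrium hp' hμ', hprat, hxrat, hyrat⟩
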